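/- arXiv:2108.00592 — 2 statements merged into one kernel-verified Lean document; each statement's English description precedes it below -/
import Mathlib

section
/- Let G be a simple graph on n vertices with walk matrix W(G). If the integer det W(G) / 2^⌊n/2⌋ (this quotient is always an integer) is odd and square-free, then G is determined by its generalized spectrum, i.e., every graph that is cospectral with G and whose complement is cospectral with the complement of G is isomorphic to G. -/
open Matrix Polynomial
open scoped Classical

noncomputable section

/-- The adjacency matrix of a simple graph on `Fin n`, with integer entries. -/
def adjMat (n : ℕ) (G : SimpleGraph (Fin n)) : Matrix (Fin n) (Fin n) ℤ :=
  Matrix.of fun i j => if G.Adj i j then 1 else 0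

/-- The walk matrix `W = [e, Ae, ..., A^{n-1}e]` of a matrix `A`. -/
def walkMat {n : ℕ} (A : Matrix (Fin n) (Fin n) ℤ) : Matrix (Fin n) (Fin n) ℤ :=
  Matrix.of fun i j => ((A ^ (j : ℕ)) *ᵥ fun _ => (1 : ℤ)) i

/-- Two graphs are generalized cospectral if they are cospectral and so are their complements. -/
def genCospectral {n : ℕ} (G H : SimpleGraph (Fin n)) : Prop :=
  (adjMat n G).charpoly = (adjMat n H).charpoly ∧
  (adjMat n Gᶜ).charpoly = (adjMat n Hᶜ).charpoly

/-- The all-ones vector. -/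
def onev (n : ℕ) : Fin n → ℤ := fun _ => 1

/-- The number of walks of length `m`. -/
def aw {n : ℕ} (A : Matrix (Fin n) (Fin n) ℤ) (m : ℕ) : ℤ := onev n ⬝ᵥ ((A ^ m) *ᵥ onev n)

lemma det_add_J_field {K : Type*} [Field K] {n : ℕ} (M : Matrix (Fin n) (Fin n) K)
    (h : M.det ≠ 0) :
    (M + Matrix.of fun _ _ => 1).det = M.det + ∑ i, ∑ j, M.adjugate i j := by
  have hJ : (Matrix.of fun _ _ => 1 : Matrix (Fin n) (Fin n) K) =
      replicateCol Unit (fun _ => (1 : K)) * replicateRow Unit (fun _ => (1 : K)) := by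
    ext i j; simp [Matrix.mul_apply]
  rw [hJ, det_add_replicateCol_mul_replicateRow (Ne.isUnit h), det_unique (n := Unit), Matrix.inv_def,
    Ring.inverse_eq_inv']
  simp only [Matrix.mul_apply, Matrix.add_apply, Matrix.one_apply_eq, replicateRow_apply,
    replicateCol_apply, Matrix.smul_apply, smul_eq_mul, mul_one, one_mul]
  rw [mul_add, mul_one, Finset.sum_comm, Finset.mul_sum]
  congr 1
  refine Finset.sum_congr rfl fun i _ => ?_
  rw [Finset.mul_sum]
  refine Finset.sum_congr rfl fun j _ => ?_
  field_simp

lemma det_add_J {R : Type*} [CommRing R] [IsDomain R] {n : ℕ} (M : Matrix (Fin n) (Fin n) R)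
    (h : M.det ≠ 0) :
    (M + Matrix.of fun _ _ => 1).det = M.det + ∑ i, ∑ j, M.adjugate i j := by
  let K := FractionRing R
  let φ : R →+* K := algebraMap R K
  have hφ : Function.Injective φ := IsFractionRing.injective R K
  apply hφ
  have h' : (φ.mapMatrix M).det ≠ 0 := by
    rw [← RingHom.map_det]
    exact fun h0 => h (hφ (by simpa using h0))
  have := det_add_J_field (φ.mapMatrix M) h'
  rw [map_add, RingHom.map_det, RingHom.map_det, map_add]
  have hJ : φ.mapMatrix (Matrix.of fun _ _ => 1 : Matrix (Fin n) (Fin n) R) =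
    Matrix.of fun _ _ => 1 := by ext i j; simp
  rw [hJ, this, ← RingHom.map_adjugate]
  simp

lemma adjMat_compl {n : ℕ} (G : SimpleGraph (Fin n)) :
    adjMat n Gᶜ = (Matrix.of fun _ _ => 1) - 1 - adjMat n G := by
  ext i j
  by_cases hij : i = j
  · subst hij; simp [adjMat]
  · by_cases h : G.Adj i j <;> simp [adjMat, hij, h]

/-- Total of the adjugate of the characteristic matrix with a power of `A`. -/
def Sm {n : ℕ} (A : Matrix (Fin n) (Fin n) ℤ) (m : ℕ) : ℤ[X] :=
  (fun _ => 1) ⬝ᵥ (((A ^ m).map (C : ℤ → ℤ[X]) * (charmatrix A).adjugate) *ᵥ fun _ => 1)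

lemma compl_det {n : ℕ} (G : SimpleGraph (Fin n)) :
    (charmatrix (adjMat n G) + Matrix.of fun _ _ => 1).det =
      (-1) ^ n * (adjMat n Gᶜ).charpoly.comp (-1 - X) := by
  have h1 : (adjMat n Gᶜ).charpoly.comp (-1 - X) =
      ((Polynomial.compRingHom (-1 - X : ℤ[X])).mapMatrix (charmatrix (adjMat n Gᶜ))).det := by
    rw [← RingHom.map_det]; rfl
  have h2 : (Polynomial.compRingHom (-1 - X : ℤ[X])).mapMatrix (charmatrix (adjMat n Gᶜ)) =
      - (charmatrix (adjMat n G) + Matrix.of fun _ _ => 1) := by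
    rw [adjMat_compl]
    ext1 i j
    by_cases hij : i = j
    · subst hij
      simp
      ring
    · simp [hij]
      ring
  rw [h1, h2, det_neg, Fintype.card_fin, ← mul_assoc, ← mul_pow]
  simp

lemma Sm_zero_eq {n : ℕ} (G : SimpleGraph (Fin n)) :
    (charmatrix (adjMat n G) + Matrix.of fun _ _ => 1).det =
      (adjMat n G).charpoly + Sm (adjMat n G) 0 := by
  rw [det_add_J _ (by exact (charpoly_monic (adjMat n G)).ne_zero)]
  congr 1
  simp [Sm, Matrix.mulVec, dotProduct, Matrix.map_one]

lemma Sm_succ {n : ℕ} (A : Matrix (Fin n) (Fin n) ℤ) (m : ℕ) :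
    Sm A (m + 1) = X * Sm A m - C (aw A m) * A.charpoly := by
  have h1 : (A ^ (m + 1)).map (C : ℤ → ℤ[X]) * (charmatrix A).adjugate =
      (X : ℤ[X]) • ((A ^ m).map (C : ℤ → ℤ[X]) * (charmatrix A).adjugate) -
        A.charpoly • (A ^ m).map (C : ℤ → ℤ[X]) := by
    have h2 : A.map (C : ℤ → ℤ[X]) = Matrix.scalar (Fin n) (X : ℤ[X]) - charmatrix A := by
      rw [charmatrix]; simp
    have h3 : (A ^ (m + 1)).map (C : ℤ → ℤ[X]) =
      (A ^ m).map (C : ℤ → ℤ[X]) * A.map (C : ℤ → ℤ[X]) := by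
      rw [pow_succ, Matrix.map_mul]
    rw [h3, h2, Matrix.mul_assoc, Matrix.sub_mul, Matrix.mul_sub, mul_adjugate]
    rw [show Matrix.scalar (Fin n) (X : ℤ[X]) = (X : ℤ[X]) • (1 : Matrix (Fin n) (Fin n) ℤ[X]) by
      simp [Matrix.smul_one_eq_diagonal]]
    simp [charpoly]
  have h4 : (fun _ => (1 : ℤ[X])) ⬝ᵥ (((A ^ m).map (C : ℤ → ℤ[X])) *ᵥ fun _ => 1) =
      C (aw A m) := by
    simp [aw, onev, Matrix.mulVec, dotProduct]
  rw [Sm, h1, Matrix.sub_mulVec, Matrix.smul_mulVec, Matrix.smul_mulVec, dotProduct_sub,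
    dotProduct_smul, dotProduct_smul, h4, ← Sm, smul_eq_mul, smul_eq_mul, mul_comm (C _)]

lemma Sm_bound {n : ℕ} (A : Matrix (Fin n) (Fin n) ℤ) :
    ∃ D, ∀ m, ∀ k, D < k → (Sm A m).coeff k = 0 := by
  refine ⟨∑ i, ∑ j, ((charmatrix A).adjugate i j).natDegree, fun m k hk => ?_⟩
  have hz : ∀ i j, ((charmatrix A).adjugate i j).coeff k = 0 := by
    intro i j
    apply coeff_eq_zero_of_natDegree_lt
    refine lt_of_le_of_lt ?_ hk
    refine le_trans ?_ (Finset.single_le_sum (f := fun i => ∑ j,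
      ((charmatrix A).adjugate i j).natDegree) (fun _ _ => Nat.zero_le _) (Finset.mem_univ i))
    exact (Finset.single_le_sum (f := fun j =>
      ((charmatrix A).adjugate i j).natDegree) (fun _ _ => Nat.zero_le _) (Finset.mem_univ j))
  simp [Sm, Matrix.mulVec, dotProduct, Matrix.mul_apply, hz]

lemma Sm_coeff {n : ℕ} (A : Matrix (Fin n) (Fin n) ℤ) (m k : ℕ) :
    (Sm A m).coeff k = aw A m * A.charpoly.coeff (k + 1) + (Sm A (m + 1)).coeff (k + 1) := by
  rw [Sm_succ, coeff_sub, coeff_X_mul, coeff_C_mul]; ring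

lemma Sm_high {n : ℕ} (A : Matrix (Fin n) (Fin n) ℤ) (m k : ℕ) (hk : n ≤ k) :
    (Sm A m).coeff k = 0 := by
  obtain ⟨D, hD⟩ := Sm_bound A
  have h : ∀ j, (Sm A m).coeff k = (Sm A (m + j)).coeff (k + j) := by
    intro j
    induction j with
    | zero => rfl
    | succ j ih =>
      rw [ih, Sm_coeff, coeff_eq_zero_of_natDegree_lt (p := A.charpoly)]
      · simp [add_assoc]
      · rw [charpoly_natDegree_eq_dim, Fintype.card_fin]; omega
  rw [h (D + 1)]
  exact hD _ _ (by omega)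

lemma aw_eq_coeff {n : ℕ} (A : Matrix (Fin n) (Fin n) ℤ) (m : ℕ) :
    aw A m = (X * Sm A m).coeff n := by
  have h := Sm_high A (m + 1) n le_rfl
  have hc : A.charpoly.coeff n = 1 := by
    have := (charpoly_monic A).coeff_natDegree
    rwa [charpoly_natDegree_eq_dim, Fintype.card_fin] at this
  rw [Sm_succ, coeff_sub, coeff_C_mul, hc] at h
  linarith

lemma aw_eq_of_genCospectral {n : ℕ} {G H : SimpleGraph (Fin n)} (h : genCospectral G H)
    (m : ℕ) : aw (adjMat n G) m = aw (adjMat n H) m := by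
  have key : ∀ m, Sm (adjMat n G) m = Sm (adjMat n H) m := by
    intro m
    induction m with
    | zero =>
      have h1 := Sm_zero_eq G
      have h2 := Sm_zero_eq H
      rw [compl_det] at h1 h2
      rw [h.2, h2, h.1] at h1
      exact (add_left_cancel h1).symm
    | succ m ih => rw [Sm_succ, Sm_succ, aw_eq_coeff, aw_eq_coeff, ih, h.1]
  rw [aw_eq_coeff, aw_eq_coeff, key]

/-- `f(A) e`. -/
def kv {n : ℕ} (A : Matrix (Fin n) (Fin n) ℤ) (f : ℤ[X]) : Fin n → ℤ := (aeval A f) *ᵥ onev n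

lemma kv_add {n : ℕ} (A : Matrix (Fin n) (Fin n) ℤ) (f g : ℤ[X]) :
    kv A (f + g) = kv A f + kv A g := by
  simp [kv, Matrix.add_mulVec]

lemma kv_sub {n : ℕ} (A : Matrix (Fin n) (Fin n) ℤ) (f g : ℤ[X]) :
    kv A (f - g) = kv A f - kv A g := by
  simp [kv, Matrix.sub_mulVec]

lemma kv_mul {n : ℕ} (A : Matrix (Fin n) (Fin n) ℤ) (f g : ℤ[X]) :
    kv A (f * g) = (aeval A f) *ᵥ kv A g := by
  simp [kv]

lemma kv_C_mul {n : ℕ} (A : Matrix (Fin n) (Fin n) ℤ) (c : ℤ) (g : ℤ[X]) :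
    kv A (C c * g) = c • kv A g := by
  rw [kv_mul, aeval_C, Algebra.algebraMap_eq_smul_one, Matrix.smul_mulVec, Matrix.one_mulVec]

lemma kv_X_pow {n : ℕ} (A : Matrix (Fin n) (Fin n) ℤ) (i : ℕ) :
    kv A (X ^ i) = A ^ i *ᵥ onev n := by
  simp [kv]

lemma kv_finset_sum {n : ℕ} (A : Matrix (Fin n) (Fin n) ℤ) {ι : Type*} (s : Finset ι)
    (f : ι → ℤ[X]) : kv A (∑ i ∈ s, f i) = ∑ i ∈ s, kv A (f i) := by
  simp [kv, Matrix.sum_mulVec]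

lemma kv_eq_sum {n : ℕ} (A : Matrix (Fin n) (Fin n) ℤ) (f : ℤ[X]) (N : ℕ)
    (hN : f.natDegree < N) :
    kv A f = ∑ i ∈ Finset.range N, f.coeff i • (A ^ i *ᵥ onev n) := by
  conv_lhs => rw [f.as_sum_range_C_mul_X_pow' hN]
  rw [kv_finset_sum]
  simp only [kv_C_mul, kv_X_pow]

lemma walkMat_mulVec {n : ℕ} (A : Matrix (Fin n) (Fin n) ℤ) (x : Fin n → ℤ) :
    walkMat A *ᵥ x = ∑ i : Fin n, x i • (A ^ (i : ℕ) *ᵥ onev n) := by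
  ext j
  simp [walkMat, Matrix.mulVec, dotProduct, onev, mul_comm]

lemma walkMat_mulVec_coeff {n : ℕ} (A : Matrix (Fin n) (Fin n) ℤ) (f : ℤ[X])
    (hf : f.natDegree < n) :
    walkMat A *ᵥ (fun i : Fin n => f.coeff i) = kv A f := by
  rw [walkMat_mulVec, kv_eq_sum A f n hf, Finset.sum_range]

lemma walkMat_mulVec_exists {n : ℕ} (A : Matrix (Fin n) (Fin n) ℤ) (x : Fin n → ℤ) :
    ∃ f, walkMat A *ᵥ x = kv A f := by
  refine ⟨∑ i : Fin n, C (x i) * X ^ (i : ℕ), ?_⟩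
  rw [walkMat_mulVec, kv_finset_sum]
  simp only [kv_C_mul, kv_X_pow]

lemma aeval_symm {n : ℕ} {A : Matrix (Fin n) (Fin n) ℤ} (hA : Aᵀ = A) (f : ℤ[X]) :
    (aeval A f)ᵀ = aeval A f := by
  rw [aeval_eq_sum_range, Matrix.transpose_sum]
  simp only [Matrix.transpose_smul, Matrix.transpose_pow, hA]

lemma dot_symm {n : ℕ} {M : Matrix (Fin n) (Fin n) ℤ} (hM : Mᵀ = M) (x y : Fin n → ℤ) :
    (M *ᵥ x) ⬝ᵥ y = x ⬝ᵥ (M *ᵥ y) := by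
  rw [Matrix.dotProduct_mulVec, ← Matrix.mulVec_transpose, hM]

lemma pow_symm {n : ℕ} {A : Matrix (Fin n) (Fin n) ℤ} (hA : Aᵀ = A) (i : ℕ) :
    (A ^ i)ᵀ = A ^ i := by
  rw [Matrix.transpose_pow, hA]

lemma dot_aw {n : ℕ} {A : Matrix (Fin n) (Fin n) ℤ} (hA : Aᵀ = A) (i j : ℕ) :
    (A ^ i *ᵥ onev n) ⬝ᵥ (A ^ j *ᵥ onev n) = aw A (i + j) := by
  rw [dot_symm (pow_symm hA i), Matrix.mulVec_mulVec, ← pow_add]; rfl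

lemma dot_kv {n : ℕ} {A : Matrix (Fin n) (Fin n) ℤ} (hA : Aᵀ = A) (f g : ℤ[X]) :
    kv A f ⬝ᵥ kv A g = onev n ⬝ᵥ kv A (f * g) := by
  conv_lhs => rw [kv]
  rw [dot_symm (aeval_symm hA f), ← kv_mul]

lemma walk_transpose_mulVec {n : ℕ} (A : Matrix (Fin n) (Fin n) ℤ) (u : Fin n → ℤ) (i : Fin n) :
    ((walkMat A)ᵀ *ᵥ u) i = (A ^ (i : ℕ) *ᵥ onev n) ⬝ᵥ u := by
  rfl

lemma WtW {n : ℕ} {A : Matrix (Fin n) (Fin n) ℤ} (hA : Aᵀ = A) (i j : Fin n) :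
    ((walkMat A)ᵀ * walkMat A) i j = aw A (i + j) := by
  rw [← dot_aw hA]; rfl

lemma right_cancel {n : ℕ} {M N W : Matrix (Fin n) (Fin n) ℤ} (hW : W.det ≠ 0)
    (h : M * W = N * W) : M = N := by
  have h1 : (M * W) * W.adjugate = (N * W) * W.adjugate := by rw [h]
  rw [Matrix.mul_assoc, Matrix.mul_assoc, mul_adjugate] at h1
  simp only [Matrix.mul_smul, Matrix.mul_one] at h1
  exact smul_right_injective _ hW h1

lemma smul_cancel {n : ℕ} {M N : Matrix (Fin n) (Fin n) ℤ} {c : ℤ} (hc : c ≠ 0)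
    (h : c • M = c • N) : M = N := smul_right_injective _ hc h

lemma P_facts {n : ℕ} {A B P : Matrix (Fin n) (Fin n) ℤ} (hA : Aᵀ = A) (hB : Bᵀ = B)
    (haw : ∀ m, aw A m = aw B m) (hc : A.charpoly = B.charpoly)
    (hdB : (walkMat B).det ≠ 0) {l : ℤ} (hl : l ≠ 0)
    (hP : P * walkMat B = l • walkMat A) :
    A * P = P * B ∧ Pᵀ * P = (l ^ 2) • (1 : Matrix (Fin n) (Fin n) ℤ) ∧
      Pᵀ * walkMat A = l • walkMat B ∧ P *ᵥ onev n = l • onev n := by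
  have hWW : (walkMat A)ᵀ * walkMat A = (walkMat B)ᵀ * walkMat B := by
    ext i j
    rw [WtW hA, WtW hB, haw]
  have h2 : Pᵀ * P = (l ^ 2) • (1 : Matrix (Fin n) (Fin n) ℤ) := by
    apply right_cancel hdB
    apply Matrix.transpose_injective
    apply right_cancel hdB
    have e1 : (Pᵀ * P * walkMat B)ᵀ * walkMat B = (P * walkMat B)ᵀ * (P * walkMat B) := by
      simp [Matrix.transpose_mul, Matrix.mul_assoc]
    rw [e1, hP]
    simp only [Matrix.transpose_smul, Matrix.smul_mul, Matrix.mul_smul, hWW, smul_smul, pow_two,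
      Matrix.one_mul]
  have h3 : Pᵀ * walkMat A = l • walkMat B := by
    apply smul_cancel hl
    rw [← Matrix.mul_smul, ← hP, ← Matrix.mul_assoc, h2]
    simp only [smul_smul, pow_two, Matrix.smul_mul, Matrix.one_mul]
  have hcol : ∀ j < n, P *ᵥ (B ^ j *ᵥ onev n) = l • (A ^ j *ᵥ onev n) := by
    intro j hj
    ext i
    have := congrFun (congrFun hP i) ⟨j, hj⟩
    exact this
  have hkv : ∀ f : ℤ[X], f.natDegree < n → P *ᵥ kv B f = l • kv A f := by
    intro f hf
    rw [kv_eq_sum B f n hf, kv_eq_sum A f n hf, Matrix.mulVec_sum, Finset.smul_sum]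
    refine Finset.sum_congr rfl fun j hj => ?_
    rw [Matrix.mulVec_smul, hcol j (Finset.mem_range.1 hj), smul_comm]
  have hcn : P *ᵥ (B ^ n *ᵥ onev n) = l • (A ^ n *ᵥ onev n) := by
    rcases Nat.eq_zero_or_pos n with h0 | hpos
    · subst h0; exact Subsingleton.elim _ _
    have hdeg : (X ^ n - A.charpoly).natDegree < n := by
      have hd : A.charpoly.degree = n := by
        rw [charpoly_degree_eq_dim, Fintype.card_fin]
      have : (X ^ n - A.charpoly).degree < (X ^ n : ℤ[X]).degree :=
        degree_sub_lt_left (by rw [degree_X_pow, hd]) (pow_ne_zero _ X_ne_zero)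
          (by rw [(charpoly_monic A).leadingCoeff, leadingCoeff_X_pow])
      rw [degree_X_pow] at this
      by_cases hz : X ^ n - A.charpoly = 0
      · rw [hz]; simpa using hpos
      · exact (natDegree_lt_iff_degree_lt hz).2 this
    have := hkv _ hdeg
    have zA : kv A A.charpoly = 0 := by
      rw [kv, aeval_self_charpoly, Matrix.zero_mulVec]
    have zB : kv B A.charpoly = 0 := by
      rw [hc, kv, aeval_self_charpoly, Matrix.zero_mulVec]
    rwa [kv_sub, kv_sub, zA, zB, sub_zero, sub_zero, kv_X_pow, kv_X_pow] at this
  have hcol' : ∀ j ≤ n, P *ᵥ (B ^ j *ᵥ onev n) = l • (A ^ j *ᵥ onev n) := by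
    intro j hj
    rcases hj.lt_or_eq with h | h
    · exact hcol j h
    · rw [h]; exact hcn
  refine ⟨?_, h2, h3, ?_⟩
  · apply right_cancel hdB
    ext i j
    have e1 : (A * P * walkMat B) i j = (A *ᵥ (P *ᵥ (B ^ (j : ℕ) *ᵥ onev n))) i := by
      rw [Matrix.mulVec_mulVec]; rfl
    have e2 : (P * B * walkMat B) i j = (P *ᵥ (B *ᵥ (B ^ (j : ℕ) *ᵥ onev n))) i := by
      rw [Matrix.mulVec_mulVec]; rfl
    rw [e1, e2, hcol j j.2, Matrix.mulVec_mulVec _ B, ← pow_succ', hcol' _ j.2,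
      Matrix.mulVec_smul, Matrix.mulVec_mulVec, ← pow_succ']
  · simpa using hcol' 0 (Nat.zero_le _)

/-- All the entries of `v` are divisible by `p`. -/
def Dv {n : ℕ} (p : ℤ) (v : Fin n → ℤ) : Prop := ∀ i, p ∣ v i

lemma Dv.dot {n : ℕ} {p : ℤ} {v : Fin n → ℤ} (h : Dv p v) (x : Fin n → ℤ) : p ∣ x ⬝ᵥ v :=
  Finset.dvd_sum fun i _ => Dvd.dvd.mul_left (h i) _

lemma Dv.mulVec {n : ℕ} {p : ℤ} {v : Fin n → ℤ} (h : Dv p v) (M : Matrix (Fin n) (Fin n) ℤ) :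
    Dv p (M *ᵥ v) := fun i => h.dot (M i)

lemma Dv.add {n : ℕ} {p : ℤ} {v w : Fin n → ℤ} (h : Dv p v) (h' : Dv p w) : Dv p (v + w) :=
  fun i => dvd_add (h i) (h' i)

lemma Dv.sub {n : ℕ} {p : ℤ} {v w : Fin n → ℤ} (h : Dv p v) (h' : Dv p w) : Dv p (v - w) :=
  fun i => dvd_sub (h i) (h' i)

lemma Dv.exists_eq {n : ℕ} {p : ℤ} {v : Fin n → ℤ} (h : Dv p v) : ∃ w, v = p • w := by
  choose w hw using h
  exact ⟨w, funext fun i => by simpa using hw i⟩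

lemma Dv_smul {n : ℕ} (p : ℤ) (v : Fin n → ℤ) : Dv p (p • v) := fun i => ⟨v i, by simp⟩

lemma map_eq_dvd {n : ℕ} (A : Matrix (Fin n) (Fin n) ℤ) (p : ℕ) {f g : ℤ[X]}
    (h : f.map (Int.castRingHom (ZMod p)) = g.map (Int.castRingHom (ZMod p))) :
    Dv p (kv A f - kv A g) := by
  have h1 : (C (p : ℤ)) ∣ f - g := by
    rw [C_dvd_iff_dvd_coeff]
    intro i
    rw [coeff_sub, ← ZMod.intCast_eq_intCast_iff_dvd_sub]
    have := congrArg (fun q => q.coeff i) h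
    simpa using this.symm
  obtain ⟨q, hq⟩ := h1
  rw [← kv_sub, hq, kv_C_mul]
  exact Dv_smul _ _

lemma exists_monic {n : ℕ} (A : Matrix (Fin n) (Fin n) ℤ) (p : ℕ) [Fact p.Prime] (f : ℤ[X]) (k : ℕ)
    (hk : f.natDegree ≤ k) (hf : f.map (Int.castRingHom (ZMod p)) ≠ 0) (h : Dv p (kv A f)) :
    ∃ g : ℤ[X], g.Monic ∧ g.natDegree ≤ k ∧ Dv p (kv A g) := by
  set F := f.map (Int.castRingHom (ZMod p)) with hF
  have hmon := monic_mul_leadingCoeff_inv hf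
  have hsurj : Function.Surjective (Int.castRingHom (ZMod p)) := ZMod.intCast_surjective
  obtain ⟨g, hg1, hg2, hg3⟩ := lifts_and_natDegree_eq_and_monic (f := Int.castRingHom (ZMod p))
    (p := F * C F.leadingCoeff⁻¹) ((mem_lifts _).2 (map_surjective _ hsurj _)) hmon
  obtain ⟨c, hc⟩ := hsurj F.leadingCoeff⁻¹
  refine ⟨g, hg3, ?_, ?_⟩
  · rw [hg2, natDegree_mul_leadingCoeff_inv _ hf]
    exact natDegree_map_le.trans hk
  · have h1 : g.map (Int.castRingHom (ZMod p)) = (C c * f).map (Int.castRingHom (ZMod p)) := by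
      rw [hg1, Polynomial.map_mul, map_C, hc, mul_comm]
    have h2 := map_eq_dvd A p h1
    rw [kv_C_mul] at h2
    intro i
    have := dvd_add (h2 i) (Dvd.dvd.mul_left (h i) c)
    simpa using this

lemma reduce_deg {n : ℕ} (A : Matrix (Fin n) (Fin n) ℤ) (p : ℤ) (g : ℤ[X]) (k : ℕ)
    (hg : g.Monic) (hk : g.natDegree ≤ k) (h : Dv p (kv A g)) (f : ℤ[X]) :
    ∃ f' : ℤ[X], f'.degree < k ∧ Dv p (kv A f - kv A f') := by
  refine ⟨f %ₘ g, ?_, ?_⟩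
  · refine (degree_modByMonic_lt f hg).trans_le ?_
    rw [degree_eq_natDegree hg.ne_zero]
    exact_mod_cast hk
  · have : f - f %ₘ g = (f /ₘ g) * g := by
      conv_lhs => enter [1]; rw [← modByMonic_add_div f g]
      ring
    rw [← kv_sub, this, kv_mul]
    exact h.mulVec _

lemma dvd_det_mul {n : ℕ} (M : Matrix (Fin n) (Fin n) ℤ) (q : ℤ) (u : Fin n → ℤ)
    (h : Dv q (M *ᵥ u)) (i : Fin n) : q ∣ M.det * u i := by
  have := h.mulVec M.adjugate i
  rw [Matrix.mulVec_mulVec, adjugate_mul, Matrix.smul_mulVec, Matrix.one_mulVec] at this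
  simpa using this

lemma det_updateCol_mulVec {n : ℕ} (M : Matrix (Fin n) (Fin n) ℤ) (x : Fin n → ℤ) (i : Fin n) :
    (M.updateCol i (M *ᵥ x)).det = x i * M.det := by
  rw [← cramer_apply, cramer_eq_adjugate_mulVec, Matrix.mulVec_mulVec, adjugate_mul,
    Matrix.smul_mulVec, Matrix.one_mulVec]
  simp [mul_comm]

lemma two_ker_aux {n : ℕ} (M : Matrix (Fin n) (Fin n) ℤ) (p : ℤ) (hp : Prime p)
    (hdet : ¬ p ^ 2 ∣ M.det) (x y : Fin n → ℤ) (hx : Dv p (M *ᵥ x)) (hy : Dv p (M *ᵥ y))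
    (i j : Fin n) (hi : ¬ p ∣ x i) : p ∣ x i * y j - x j * y i := by
  by_contra hc
  obtain ⟨w, hw⟩ := hx.exists_eq
  set y' : Fin n → ℤ := x i • y - y i • x with hy'
  have hyi : y' i = 0 := by simp [hy']; ring
  set M1 := M.updateCol i w with hM1
  have h1 : p * M1.det = x i * M.det := by
    rw [← det_updateCol_mulVec, hw, det_updateCol_smul]
  have h2 : M1 *ᵥ y' = M *ᵥ y' := by
    ext r
    simp only [Matrix.mulVec, dotProduct]
    refine Finset.sum_congr rfl fun c _ => ?_
    by_cases hci : c = i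
    · rw [hci, hyi, mul_zero, mul_zero]
    · rw [hM1, updateCol_ne hci]
  have h3 : Dv p (M1 *ᵥ y') := by
    rw [h2, hy', Matrix.mulVec_sub, Matrix.mulVec_smul, Matrix.mulVec_smul]
    exact fun r => dvd_sub (Dvd.dvd.mul_left (hy r) _) (Dvd.dvd.mul_left (hx r) _)
  have h4 := dvd_det_mul M1 p y' h3 j
  have h5 : ¬ p ∣ y' j := by
    intro h; apply hc
    have e : y' j = x i * y j - x j * y i := by simp [hy']; ring
    rwa [← e]
  have h6 : p ∣ M1.det := (hp.dvd_or_dvd h4).resolve_right h5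
  have h7 : p ^ 2 ∣ x i * M.det := by
    rw [← h1, pow_two]; exact mul_dvd_mul_left p h6
  exact hdet (hp.pow_dvd_of_dvd_mul_left 2 hi h7)

lemma rank1_dot {n : ℕ} (M : Matrix (Fin n) (Fin n) ℤ) (p : ℤ) (hp : Prime p)
    (hdet : ¬ p ^ 2 ∣ M.det) (x y : Fin n → ℤ) (hx : Dv p (M *ᵥ x)) (hy : Dv p (M *ᵥ y))
    (hx0 : ¬ Dv p x) (v : Fin n → ℤ) (hv : p ∣ x ⬝ᵥ v) : p ∣ y ⬝ᵥ v := by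
  simp only [Dv, not_forall] at hx0
  obtain ⟨i, hi⟩ := hx0
  refine (hp.dvd_or_dvd (?_ : p ∣ x i * (y ⬝ᵥ v))).resolve_left hi
  have h1 : x i * (y ⬝ᵥ v) = y i * (x ⬝ᵥ v) + ∑ j, (x i * y j - x j * y i) * v j := by
    simp only [dotProduct, Finset.mul_sum, ← Finset.sum_add_distrib]
    exact Finset.sum_congr rfl fun j _ => by ring
  rw [h1]
  exact dvd_add (Dvd.dvd.mul_left hv _) (Finset.dvd_sum fun j _ =>
    Dvd.dvd.mul_right (two_ker_aux M p hp hdet x y hx hy i j hi) _)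

lemma exists_ker {n : ℕ} (M : Matrix (Fin n) (Fin n) ℤ) (p : ℕ) [Fact p.Prime]
    (h : (p : ℤ) ∣ M.det) : ∃ z : Fin n → ℤ, ¬ Dv p z ∧ Dv p (M *ᵥ z) := by
  have h0 : ((Int.castRingHom (ZMod p)).mapMatrix M).det = 0 := by
    rw [← RingHom.map_det]
    exact (ZMod.intCast_zmod_eq_zero_iff_dvd _ _).2 h
  obtain ⟨v, hv, hv0⟩ := Matrix.exists_mulVec_eq_zero_iff.2 h0
  choose z hz using fun i => ZMod.intCast_surjective (v i)
  refine ⟨z, fun hd => hv ?_, fun i => ?_⟩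
  · ext i
    rw [← hz]
    exact (ZMod.intCast_zmod_eq_zero_iff_dvd _ _).2 (hd i)
  · rw [← ZMod.intCast_zmod_eq_zero_iff_dvd]
    have := congrFun hv0 i
    rw [Pi.zero_apply] at this
    rw [← this]
    simp [Matrix.mulVec, dotProduct, hz]

lemma exists_inv (p : ℤ) (hp : Prime p) (m : ℤ) (hm : ¬ p ∣ m) : ∃ c, p ∣ c * m - 1 := by
  obtain ⟨a, b, hab⟩ := (hp.coprime_iff_not_dvd.2 hm)
  exact ⟨b, -a, by linarith⟩

lemma coeff_vec {n : ℕ} (z : Fin n → ℤ) :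
    ∃ f : ℤ[X], f.degree < n ∧ ∀ i : Fin n, f.coeff i = z i := by
  refine ⟨∑ i : Fin n, C (z i) * X ^ (i : ℕ), ?_, fun i => ?_⟩
  · refine (degree_sum_le _ _).trans_lt ?_
    refine (Finset.sup_lt_iff (WithBot.bot_lt_coe n)).2 ?_
    intro i _
    refine (degree_C_mul_X_pow_le _ _).trans_lt ?_
    have h : ((i : ℕ) : WithBot ℕ) < (n : WithBot ℕ) := by exact_mod_cast i.2
    exact h
  · simp [finsetSum_coeff, coeff_X_pow, Fin.ext_iff.symm]

lemma kv_deg {n : ℕ} (A : Matrix (Fin n) (Fin n) ℤ) (f : ℤ[X])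
    (hf : f.degree < n) :
    walkMat A *ᵥ (fun i : Fin n => f.coeff i) = kv A f := by
  by_cases h0 : f = 0
  · subst h0
    simp only [coeff_zero, kv, map_zero, Matrix.zero_mulVec]
    exact Matrix.mulVec_zero _
  · exact walkMat_mulVec_coeff A f ((natDegree_lt_iff_degree_lt h0).2 hf)

lemma odd_case {n : ℕ} {A : Matrix (Fin n) (Fin n) ℤ} (hA : Aᵀ = A) (p : ℕ) (hpn : p.Prime)
    (hdet : ¬ (p : ℤ) ^ 2 ∣ (walkMat A).det) (u : Fin n → ℤ)
    (hu : Dv p ((walkMat A)ᵀ *ᵥ u)) (hAu : Dv p ((walkMat A)ᵀ *ᵥ (A *ᵥ u)))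
    (huu : (p : ℤ) ^ 2 ∣ u ⬝ᵥ u) (huAu : (p : ℤ) ^ 2 ∣ u ⬝ᵥ (A *ᵥ u)) : Dv p u := by
  have : Fact p.Prime := ⟨hpn⟩
  have hp : Prime (p : ℤ) := Nat.prime_iff_prime_int.1 hpn
  by_contra hu0
  have hu0' := hu0
  simp only [Dv, not_forall] at hu0'
  obtain ⟨i0, hi0⟩ := hu0'
  set W := walkMat A with hW
  have hdetT : ¬ (p : ℤ) ^ 2 ∣ Wᵀ.det := by rwa [det_transpose]
  -- `p` divides `det W`
  have hpd : (p : ℤ) ∣ W.det := by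
    have := dvd_det_mul Wᵀ p u hu i0
    rw [det_transpose] at this
    exact (hp.dvd_or_dvd this).resolve_right hi0
  obtain ⟨m, hm⟩ := hpd
  have hpm : ¬ (p : ℤ) ∣ m := by
    rintro ⟨t, ht⟩
    exact hdet ⟨t, by rw [hm, ht]; ring⟩
  have hp0 : (p : ℤ) ≠ 0 := hp.ne_zero
  -- eigenvalue
  obtain ⟨c, hc⟩ := exists_inv p hp (u i0) hi0
  obtain ⟨lam, hlam⟩ : ∃ lam : ℤ, Dv p (A *ᵥ u - lam • u) := by
    refine ⟨c * (A *ᵥ u) i0, fun j => ?_⟩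
    have h1 := two_ker_aux Wᵀ p hp hdetT u (A *ᵥ u) hu hAu i0 j hi0
    have h2 : (A *ᵥ u - (c * (A *ᵥ u) i0) • u) j =
      c * (u i0 * (A *ᵥ u) j - u j * (A *ᵥ u) i0) - (c * u i0 - 1) * (A *ᵥ u) j := by
      simp; ring
    rw [h2]
    exact dvd_sub (Dvd.dvd.mul_left h1 _) (Dvd.dvd.mul_right hc _)
  -- `u` lies in the image of `W` mod `p`
  have hadj : Dv p (W.adjugate *ᵥ u) := by
    intro r
    have hrow : Dv p (Wᵀ *ᵥ (W.adjugate r)) := by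
      intro j
      have : (Wᵀ *ᵥ (W.adjugate r)) j = (W.adjugate * W) r j := by
        simp [Matrix.mulVec, dotProduct, Matrix.mul_apply, mul_comm]
      rw [this, adjugate_mul, hm]
      exact ⟨m * (1 : Matrix (Fin n) (Fin n) ℤ) r j, by simp [mul_assoc]⟩
    exact rank1_dot Wᵀ p hp hdetT u (W.adjugate r) hu hrow hu0 u
      (dvd_trans (dvd_pow_self _ two_ne_zero) huu)
  obtain ⟨x, hx⟩ := hadj.exists_eq
  have hWx : W *ᵥ x = m • u := by
    have h1 : W *ᵥ (W.adjugate *ᵥ u) = W.det • u := by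
      rw [Matrix.mulVec_mulVec, mul_adjugate, Matrix.smul_mulVec, Matrix.one_mulVec]
    rw [hx, hm, Matrix.mulVec_smul, mul_smul] at h1
    exact smul_right_injective _ hp0 h1
  obtain ⟨d, hd⟩ := exists_inv p hp m hpm
  obtain ⟨h0, hh0⟩ := walkMat_mulVec_exists A (d • x)
  have hu1 : Dv p (u - kv A h0) := by
    intro i
    rw [← hh0, Matrix.mulVec_smul, ← hW, hWx]
    have : (u - d • m • u) i = - ((d * m - 1) * u i) := by simp; ring
    rw [this]
    exact (Dvd.dvd.mul_right hd _).neg_right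
  -- reduction of the degree
  obtain ⟨z0, hz0, hWz0⟩ := exists_ker W p ⟨m, hm⟩
  obtain ⟨f, hfdeg, hfc⟩ := coeff_vec z0
  have hn : 0 < n := Fin.pos i0
  have hfk : Dv p (kv A f) := by
    rw [← kv_deg A f hfdeg]
    simp only [hfc]
    exact hWz0
  have hf0 : f.map (Int.castRingHom (ZMod p)) ≠ 0 := by
    intro h
    apply hz0
    intro i
    rw [← hfc, ← ZMod.intCast_zmod_eq_zero_iff_dvd]
    have := congrArg (fun q => q.coeff (i : ℕ)) h
    simpa using this
  have hfn : f.natDegree ≤ n - 1 := by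
    rw [natDegree_le_iff_degree_le]
    rw [degree_lt_iff_coeff_zero] at hfdeg
    rw [degree_le_iff_coeff_zero]
    intro k hk
    exact hfdeg k (by have : n - 1 < k := by exact_mod_cast hk
                      omega)
  obtain ⟨g, hg1, hg2, hg3⟩ := exists_monic A p f (n - 1) hfn hf0 hfk
  obtain ⟨h, hhdeg, hhk⟩ := reduce_deg A p g (n - 1) hg1 hg2 hg3 h0
  have hu2 : Dv p (u - kv A h) := by
    have := hu1.add hhk
    simpa using this
  obtain ⟨r, hr⟩ := hu2.exists_eq
  -- the kernel vector
  set q : ℤ[X] := (X - C lam) * h with hq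
  have hqdeg : q.degree < n := by
    rw [hq, degree_mul, degree_X_sub_C]
    rcases eq_or_ne h 0 with rfl | hne
    · simp
    · rw [degree_eq_natDegree hne] at hhdeg ⊢
      have : h.natDegree < n - 1 := by exact_mod_cast hhdeg
      have : 1 + h.natDegree < n := by omega
      exact_mod_cast this
  set z : Fin n → ℤ := fun i => q.coeff i with hz
  have hkvh : kv A h = u - (p : ℤ) • r := by rw [← hr]; simp
  have hWz : W *ᵥ z = (A *ᵥ u - lam • u) - (p : ℤ) • (A *ᵥ r - lam • r) := by
    have e : (aeval A (X - C lam)) = A - lam • (1 : Matrix (Fin n) (Fin n) ℤ) := by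
      rw [map_sub, aeval_X, aeval_C, Algebra.algebraMap_eq_smul_one]
    rw [hW, hz, kv_deg A q hqdeg, hq, kv_mul, hkvh, e, Matrix.mulVec_sub, Matrix.mulVec_smul,
      Matrix.sub_mulVec, Matrix.sub_mulVec, Matrix.smul_mulVec, Matrix.smul_mulVec,
      Matrix.one_mulVec, Matrix.one_mulVec]
  have hWzp : Dv p (W *ᵥ z) := by
    rw [hWz]; exact hlam.sub (Dv_smul _ _)
  have hz1 : ¬ Dv p z := by
    intro hzd
    have hq0 : q.map (Int.castRingHom (ZMod p)) = 0 := by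
      ext k
      rw [coeff_map, coeff_zero, eq_intCast]
      by_cases hk : k < n
      · exact (ZMod.intCast_zmod_eq_zero_iff_dvd _ _).2 (hzd ⟨k, hk⟩)
      · rw [degree_lt_iff_coeff_zero] at hqdeg
        rw [hqdeg k (by omega)]; simp
    rw [hq, Polynomial.map_mul, mul_eq_zero, Polynomial.map_sub, map_X, map_C] at hq0
    have hh : h.map (Int.castRingHom (ZMod p)) = (0 : ℤ[X]).map (Int.castRingHom (ZMod p)) := by
      rw [Polynomial.map_zero]; exact hq0.resolve_left (X_sub_C_ne_zero _)
    have h3 := map_eq_dvd A p hh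
    apply hu0
    have := hu2.add h3
    simpa [kv, Matrix.zero_mulVec] using this
  obtain ⟨v, hv⟩ := hu.exists_eq
  have hvz : (p : ℤ) ∣ z ⬝ᵥ v := by
    have e1 : u ⬝ᵥ (W *ᵥ z) = p * (z ⬝ᵥ v) := by
      rw [Matrix.dotProduct_mulVec, ← Matrix.mulVec_transpose, hv, smul_dotProduct, dotProduct_comm,
        smul_eq_mul]
    have e2 : u ⬝ᵥ (W *ᵥ z) = (u ⬝ᵥ (A *ᵥ u) - lam * (u ⬝ᵥ u))
        - p * (r ⬝ᵥ (A *ᵥ u - lam • u)) := by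
      rw [hWz]
      simp only [dotProduct_sub, dotProduct_smul, smul_eq_mul]
      rw [← dot_symm hA u r, dotProduct_comm (A *ᵥ u) r, dotProduct_comm u r]
    have e3 : (p : ℤ) ^ 2 ∣ p * (z ⬝ᵥ v) := by
      rw [← e1, e2]
      refine dvd_sub (dvd_sub huAu (Dvd.dvd.mul_left huu _)) ?_
      rw [pow_two]
      exact mul_dvd_mul_left _ (hlam.dot r)
    rw [pow_two] at e3
    exact (mul_dvd_mul_iff_left hp0).1 e3
  have hadj2 : ∀ j, (p : ℤ) ∣ (fun i => W.adjugate i j) ⬝ᵥ v := by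
    intro j
    refine rank1_dot W p hp hdet z _ hWzp ?_ hz1 v hvz
    intro i
    have : (W *ᵥ fun i => W.adjugate i j) i = (W * W.adjugate) i j := rfl
    rw [this, mul_adjugate, hm]
    exact ⟨m * (1 : Matrix (Fin n) (Fin n) ℤ) i j, by simp [mul_assoc]⟩
  have hfin : (p : ℤ) ^ 2 ∣ W.det * u i0 := by
    have e1 : (Wᵀ.adjugate *ᵥ (Wᵀ *ᵥ u)) i0 = W.det * u i0 := by
      rw [Matrix.mulVec_mulVec, adjugate_mul, Matrix.smul_mulVec, Matrix.one_mulVec, det_transpose]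
      simp
    have e2 : (Wᵀ.adjugate *ᵥ (Wᵀ *ᵥ u)) i0 = p * ((fun i => W.adjugate i i0) ⬝ᵥ v) := by
      rw [hv, Matrix.mulVec_smul, ← adjugate_transpose]
      rfl
    rw [← e1, e2, pow_two]
    exact mul_dvd_mul_left _ (hadj2 i0)
  exact hdet (hp.pow_dvd_of_dvd_mul_right 2 hi0 hfin)

lemma quad_even {n : ℕ} {A : Matrix (Fin n) (Fin n) ℤ} (hA : Aᵀ = A) (hd : ∀ i, A i i = 0)
    (y : Fin n → ℤ) : (2 : ℤ) ∣ y ⬝ᵥ (A *ᵥ y) := by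
  rw [show (2 : ℤ) = ((2 : ℕ) : ℤ) by rfl, ← ZMod.intCast_zmod_eq_zero_iff_dvd]
  have h1 : ((y ⬝ᵥ (A *ᵥ y) : ℤ) : ZMod 2) =
      ∑ q : Fin n × Fin n, ((y q.1 * (A q.1 q.2 * y q.2) : ℤ) : ZMod 2) := by
    rw [Fintype.sum_prod_type]
    simp [Matrix.mulVec, dotProduct, Finset.mul_sum]
  rw [h1]
  refine Finset.sum_involution (fun q _ => (q.2, q.1)) ?_ ?_ ?_ ?_
  · intro q _
    have : A q.2 q.1 = A q.1 q.2 := congrFun (congrFun hA q.1) q.2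
    simp only [this]
    have e : y q.2 * (A q.1 q.2 * y q.1) = y q.1 * (A q.1 q.2 * y q.2) := by ring
    rw [e]
    exact CharTwo.add_self_eq_zero _
  · intro q _ hq heq
    apply hq
    have : q.1 = q.2 := (congrArg Prod.snd heq)
    rw [← this, hd]; simp
  · intro q _; exact Finset.mem_univ _
  · intro q _; rfl

lemma sq_even {n : ℕ} (y : Fin n → ℤ) : (2 : ℤ) ∣ y ⬝ᵥ y - onev n ⬝ᵥ y := by
  rw [← sub_dotProduct]
  refine Finset.dvd_sum fun i _ => ?_
  have := Int.even_mul_pred_self (y i)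
  rw [mul_comm] at this
  exact this.two_dvd

lemma aw_even {n : ℕ} {A : Matrix (Fin n) (Fin n) ℤ} (hA : Aᵀ = A) (hd : ∀ i, A i i = 0)
    (m : ℕ) (hm : 1 ≤ m) : (2 : ℤ) ∣ aw A m := by
  induction m using Nat.strong_induction_on with
  | _ m ih =>
    rcases Nat.even_or_odd' m with ⟨k, hk | hk⟩
    · have h1 := sq_even (A ^ k *ᵥ onev n)
      rw [dot_aw hA, ← two_mul, ← hk] at h1
      have h2 := ih k (by omega) (by omega)
      have : aw A m = (aw A m - onev n ⬝ᵥ (A ^ k *ᵥ onev n)) + aw A k := by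
        unfold aw; ring
      rw [this]
      exact dvd_add h1 h2
    · have h1 := quad_even hA hd (A ^ k *ᵥ onev n)
      rw [Matrix.mulVec_mulVec, ← pow_succ', dot_aw hA] at h1
      rwa [hk, show 2 * k + 1 = k + (k + 1) by ring]

lemma aw_zero {n : ℕ} (A : Matrix (Fin n) (Fin n) ℤ) : aw A 0 = n := by
  simp [aw, onev, dotProduct]

lemma aw_even' {n : ℕ} {A : Matrix (Fin n) (Fin n) ℤ} (hA : Aᵀ = A) (hd : ∀ i, A i i = 0)
    (m : ℕ) (hm : n % 2 = 0 ∨ 1 ≤ m) : (2 : ℤ) ∣ aw A m := by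
  rcases Nat.eq_zero_or_pos m with h | h
  · subst h
    rw [aw_zero]
    have : 2 ∣ n := by omega
    exact_mod_cast this
  · exact aw_even hA hd m h

lemma kv_even {n : ℕ} {A : Matrix (Fin n) (Fin n) ℤ} (hA : Aᵀ = A) (hd : ∀ i, A i i = 0)
    (f : ℤ[X]) (hf : n % 2 = 0 ∨ f.coeff 0 = 0) : (2 : ℤ) ∣ onev n ⬝ᵥ kv A f := by
  rw [kv_eq_sum A f (f.natDegree + 1) (Nat.lt_succ_self _), dotProduct_sum]
  refine Finset.dvd_sum fun i _ => ?_
  rw [dotProduct_smul, smul_eq_mul]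
  rcases hf with h | h
  · exact Dvd.dvd.mul_left (aw_even' hA hd i (Or.inl h)) _
  · rcases Nat.eq_zero_or_pos i with h0 | h0
    · subst h0; rw [h]; simp
    · exact Dvd.dvd.mul_left (aw_even' hA hd i (Or.inr h0)) _

/-- Scaling factors of the rows of `Wᵀ W`. -/
def dfac (n : ℕ) (i : Fin n) : ℤ := if (i : ℕ) = 0 ∧ n % 2 = 1 then 1 else 2

lemma dfac_prod (n : ℕ) : ∏ i, dfac n i = (2 ^ (n / 2)) ^ 2 := by
  rw [← pow_mul]
  cases n with
  | zero => simp
  | succ k =>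
    rw [Fin.prod_univ_succ]
    have h1 : ∀ i : Fin k, dfac (k + 1) i.succ = 2 := by intro i; simp [dfac]
    simp only [h1, Finset.prod_const, Finset.card_univ, Fintype.card_fin]
    rcases Nat.even_or_odd' k with ⟨j, hj | hj⟩
    · have e1 : (k + 1) % 2 = 1 := by omega
      have e2 : (k + 1) / 2 * 2 = k := by omega
      simp [dfac, e1, e2]
    · have e1 : (k + 1) % 2 = 0 := by omega
      have e2 : (k + 1) / 2 * 2 = k + 1 := by omega
      simp [dfac, e1, e2, pow_succ']

lemma exists_N {n : ℕ} {A : Matrix (Fin n) (Fin n) ℤ} (hA : Aᵀ = A) (hd : ∀ i, A i i = 0) :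
    ∃ N : Matrix (Fin n) (Fin n) ℤ, (walkMat A)ᵀ * walkMat A = diagonal (dfac n) * N := by
  refine ⟨Matrix.of fun i j => aw A (i + j) / dfac n i, ?_⟩
  ext i j
  rw [WtW hA, diagonal_mul, Matrix.of_apply, Int.mul_ediv_cancel']
  unfold dfac
  split_ifs with h
  · exact one_dvd _
  · exact aw_even' hA hd _ (by omega)

lemma det_N {n : ℕ} {A N : Matrix (Fin n) (Fin n) ℤ}
    (hN : (walkMat A)ᵀ * walkMat A = diagonal (dfac n) * N) :
    (walkMat A).det ^ 2 = (2 ^ (n / 2)) ^ 2 * N.det := by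
  have := congrArg Matrix.det hN
  rw [det_mul, det_mul, det_transpose, det_diagonal, dfac_prod] at this
  rw [← this]; ring

lemma pow_dvd_det {n : ℕ} {A : Matrix (Fin n) (Fin n) ℤ} (hA : Aᵀ = A) (hd : ∀ i, A i i = 0) :
    (2 : ℤ) ^ (n / 2) ∣ (walkMat A).det := by
  obtain ⟨N, hN⟩ := exists_N hA hd
  exact (Int.pow_dvd_pow_iff two_ne_zero).1 ⟨_, det_N hN⟩

lemma exists_monic_two {n : ℕ} {A : Matrix (Fin n) (Fin n) ℤ} (hA : Aᵀ = A)
    (hd : ∀ i, A i i = 0) :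
    ∃ g : ℤ[X], g.Monic ∧ g.natDegree ≤ (n + 1) / 2 ∧ Dv ((2 : ℕ) : ℤ) (kv A g) := by
  have : Fact (Nat.Prime 2) := ⟨Nat.prime_two⟩
  set s := n % 2 with hs
  set r := n / 2 + 1 with hr
  let L : Matrix (Fin n) (Fin r) (ZMod 2) :=
    Matrix.of fun i j => (((A ^ ((j : ℕ) + s) *ᵥ onev n) i : ℤ) : ZMod 2)
  have hLL : Lᵀ * L = 0 := by
    ext i j
    have h1 : (Lᵀ * L) i j = ((aw A ((i + s) + (j + s)) : ℤ) : ZMod 2) := by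
      rw [← dot_aw hA]
      simp [L, Matrix.mul_apply, dotProduct]
    rw [h1, Matrix.zero_apply]
    exact (ZMod.intCast_zmod_eq_zero_iff_dvd _ 2).2 (aw_even' hA hd _ (by omega))
  have hx : ∃ x : Fin r → ZMod 2, x ≠ 0 ∧ L *ᵥ x = 0 := by
    by_contra hcon
    push Not at hcon
    have hinj : Function.Injective L.mulVecLin := by
      rw [injective_iff_map_eq_zero]
      intro x hx
      by_contra h0
      exact hcon x h0 hx
    have hrk : L.rank = r := by
      rw [Matrix.rank, LinearMap.finrank_range_of_inj hinj]
      simp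
    have h2 := rank_add_rank_le_card_of_mul_eq_zero hLL
    rw [rank_transpose, hrk, Fintype.card_fin] at h2
    omega
  obtain ⟨x, hx0, hLx⟩ := hx
  choose z hz using fun i => ZMod.intCast_surjective (x i)
  obtain ⟨f, hf1, hf2⟩ := coeff_vec z
  have hfr : f.natDegree < r := by
    by_cases h0 : f = 0
    · subst h0; simp [hr]
    · exact (natDegree_lt_iff_degree_lt h0).2 hf1
  have hkv : kv A (X ^ s * f) = ∑ j : Fin r, z j • (A ^ ((j : ℕ) + s) *ᵥ onev n) := by
    rw [kv_mul, kv_eq_sum A f r hfr, Matrix.mulVec_sum, Finset.sum_range]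
    refine Finset.sum_congr rfl fun j _ => ?_
    rw [Matrix.mulVec_smul, hf2, map_pow, aeval_X, Matrix.mulVec_mulVec, ← pow_add, add_comm s]
  refine exists_monic A 2 (X ^ s * f) _ ?_ ?_ ?_
  · refine natDegree_mul_le.trans ?_
    rw [natDegree_X_pow]
    omega
  · rw [Polynomial.map_mul, Polynomial.map_pow, map_X]
    refine mul_ne_zero (pow_ne_zero _ X_ne_zero) fun h0 => hx0 ?_
    ext i
    have := congrArg (fun q => q.coeff (i : ℕ)) h0
    simp only [coeff_map, hf2, coeff_zero, eq_intCast] at this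
    rw [← hz, this]; rfl
  · rw [hkv]
    intro i
    rw [← ZMod.intCast_zmod_eq_zero_iff_dvd]
    have := congrFun hLx i
    rw [Pi.zero_apply] at this
    rw [← this]
    simp [L, Matrix.mulVec, dotProduct, hz, mul_comm]

lemma sq_expand (h : ℤ[X]) : ∃ s : ℤ[X], h * h = expand ℤ 2 h + C 2 * s := by
  have : Fact (Nat.Prime 2) := ⟨Nat.prime_two⟩
  have h1 : C (2 : ℤ) ∣ h * h - expand ℤ 2 h := by
    rw [C_dvd_iff_dvd_coeff]
    intro i
    have e : ((h * h - expand ℤ 2 h).map (Int.castRingHom (ZMod 2))).coeff i = 0 := by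
      rw [Polynomial.map_sub, Polynomial.map_mul, map_expand, ZMod.expand_card, pow_two, sub_self,
        coeff_zero]
    rw [coeff_map] at e
    exact (ZMod.intCast_zmod_eq_zero_iff_dvd _ 2).1 e
  obtain ⟨s, hs⟩ := h1
  exact ⟨s, by rw [← hs]; ring⟩

lemma two_case {n : ℕ} {A : Matrix (Fin n) (Fin n) ℤ} (hA : Aᵀ = A) (hd : ∀ i, A i i = 0)
    (hodd : Odd ((walkMat A).det / 2 ^ (n / 2))) (u : Fin n → ℤ)
    (hu : Dv 2 ((walkMat A)ᵀ *ᵥ u))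
    (huAu : ∀ l, (4 : ℤ) ∣ u ⬝ᵥ (A ^ l *ᵥ u)) : Dv 2 u := by
  have hp2 : Prime (2 : ℤ) := Int.prime_two
  obtain ⟨N, hN⟩ := exists_N hA hd
  have hdN := det_N hN
  obtain ⟨m, hm⟩ := pow_dvd_det hA hd
  have h20 : (2 : ℤ) ^ (n / 2) ≠ 0 := pow_ne_zero _ two_ne_zero
  rw [hm, Int.mul_ediv_cancel_left _ h20] at hodd
  have hNm : N.det = m ^ 2 := by
    rw [hm, mul_pow] at hdN
    exact (mul_left_cancel₀ (pow_ne_zero 2 h20) hdN).symm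
  have hm2 : ¬ (2 : ℤ) ∣ m := by
    rw [← even_iff_two_dvd, Int.not_even_iff_odd]; exact hodd
  have hN2 : ¬ (2 : ℤ) ∣ N.det := by
    rw [hNm]; exact fun h => hm2 (hp2.dvd_of_dvd_pow h)
  have hW0 : (walkMat A).det ≠ 0 := by
    rw [hm]
    refine mul_ne_zero h20 fun h => hm2 (by rw [h]; exact dvd_zero _)
  have hWT0 : (walkMat A)ᵀ.det ≠ 0 := by rwa [det_transpose]
  obtain ⟨v, hv⟩ := hu.exists_eq
  -- `u` lies in the image of `W` mod 2
  let v' : Fin n → ℤ := fun i => (2 / dfac n i) * v i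
  have hDv' : diagonal (dfac n) *ᵥ v' = (2 : ℤ) • v := by
    ext i
    rw [mulVec_diagonal]
    simp only [v', dfac, Pi.smul_apply, smul_eq_mul]
    split_ifs <;> simp
  have hWx : walkMat A *ᵥ (N.adjugate *ᵥ v') = N.det • u := by
    have e : (walkMat A)ᵀ *ᵥ (walkMat A *ᵥ (N.adjugate *ᵥ v')) = (walkMat A)ᵀ *ᵥ (N.det • u) := by
      rw [Matrix.mulVec_mulVec, hN, Matrix.mulVec_smul, hv, ← hDv', ← Matrix.mulVec_mulVec,
        Matrix.mulVec_mulVec _ N, mul_adjugate, Matrix.smul_mulVec, Matrix.one_mulVec,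
        Matrix.mulVec_smul]
    have e0 := Matrix.eq_zero_of_mulVec_eq_zero hWT0 (v := walkMat A *ᵥ (N.adjugate *ᵥ v')
      - N.det • u) (by rw [Matrix.mulVec_sub, e, sub_self])
    exact sub_eq_zero.1 e0
  obtain ⟨h0, hh0⟩ := walkMat_mulVec_exists A (N.adjugate *ᵥ v')
  have hu1 : Dv 2 (u - kv A h0) := by
    intro i
    rw [← hh0, hWx]
    have e : (u - N.det • u) i = (1 - N.det) * u i := by simp; ring
    rw [e]
    refine Dvd.dvd.mul_right ?_ _
    omega
  obtain ⟨g, hg1, hg2, hg3⟩ := exists_monic_two hA hd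
  obtain ⟨h1, hdeg1, hh1⟩ := reduce_deg A 2 g _ hg1 hg2 hg3 h0
  have hu2 : Dv 2 (u - kv A h1) := by
    have := hu1.add hh1
    simpa using this
  -- remove the constant term when `n` is odd
  obtain ⟨h, hdeg, hu3, hc0⟩ : ∃ h : ℤ[X], h.degree < ((n + 1) / 2 : ℕ) ∧ Dv 2 (u - kv A h) ∧
      (n % 2 = 0 ∨ h.coeff 0 = 0) := by
    rcases Nat.mod_two_eq_zero_or_one n with hn | hn
    · exact ⟨h1, hdeg1, hu2, Or.inl hn⟩
    have hnpos : 0 < n := by omega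
    have hev : (2 : ℤ) ∣ h1.coeff 0 := by
      have e1 : (2 : ℤ) ∣ onev n ⬝ᵥ u := by
        have := hu ⟨0, hnpos⟩
        rw [walk_transpose_mulVec] at this
        simpa using this
      have e2 : (2 : ℤ) ∣ onev n ⬝ᵥ kv A h1 := by
        have := dvd_sub e1 (hu2.dot (onev n))
        rwa [dotProduct_sub, sub_sub_cancel] at this
      have e3 : (2 : ℤ) ∣ onev n ⬝ᵥ kv A (h1 - C (h1.coeff 0) * X ^ 0) :=
        kv_even hA hd _ (Or.inr (by simp))
      rw [kv_sub, kv_C_mul, kv_X_pow, dotProduct_sub, dotProduct_smul] at e3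
      have e4 := dvd_sub e2 e3
      rw [sub_sub_cancel] at e4
      have e5 : onev n ⬝ᵥ (A ^ 0 *ᵥ onev n) = n := aw_zero A
      rw [e5, smul_eq_mul] at e4
      refine (hp2.dvd_or_dvd e4).resolve_right ?_
      omega
    refine ⟨h1 - C (h1.coeff 0) * X ^ 0, ?_, ?_, Or.inr (by simp)⟩
    · refine (degree_sub_le _ _).trans_lt (max_lt hdeg1 ?_)
      refine (degree_C_mul_X_pow_le _ _).trans_lt ?_
      have : 0 < (n + 1) / 2 := by omega
      exact_mod_cast this
    · rw [kv_sub, kv_C_mul]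
      have e : u - (kv A h1 - h1.coeff 0 • kv A (X ^ 0)) =
        (u - kv A h1) + h1.coeff 0 • kv A (X ^ 0) := by abel
      rw [e]
      exact hu2.add fun i => by
        rw [Pi.smul_apply, smul_eq_mul]; exact Dvd.dvd.mul_right hev _
  obtain ⟨r, hr⟩ := hu3.exists_eq
  have hur : u = kv A h + (2 : ℤ) • r := by rw [← hr]; abel
  obtain ⟨s, hs⟩ := sq_expand h
  have hs0 : n % 2 = 0 ∨ s.coeff 0 = 0 := by
    rcases hc0 with hc | hc
    · exact Or.inl hc
    · right
      have := congrArg (fun q => q.coeff 0) hs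
      simp only [mul_coeff_zero, hc, coeff_add, coeff_C_zero] at this
      rw [coeff_expand (by norm_num)] at this
      simp [hc] at this
      exact this
  have hexp : ∀ l : ℕ, (4 : ℤ) ∣ onev n ⬝ᵥ kv A (X ^ l * expand ℤ 2 h) := by
    intro l
    have e1 : u ⬝ᵥ (A ^ l *ᵥ u) = kv A h ⬝ᵥ (A ^ l *ᵥ kv A h)
        + 4 * (r ⬝ᵥ (A ^ l *ᵥ kv A h)) + 4 * (r ⬝ᵥ (A ^ l *ᵥ r)) := by
      have e0 : kv A h ⬝ᵥ (A ^ l *ᵥ r) = r ⬝ᵥ (A ^ l *ᵥ kv A h) := by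
        rw [← dot_symm (pow_symm hA l), dotProduct_comm]
      rw [hur]
      simp only [Matrix.mulVec_add, Matrix.mulVec_smul, dotProduct_add, add_dotProduct,
        dotProduct_smul, smul_dotProduct, smul_eq_mul, e0]
      ring
    have e2 : kv A h ⬝ᵥ (A ^ l *ᵥ kv A h) = onev n ⬝ᵥ kv A (X ^ l * expand ℤ 2 h)
        + 2 * (onev n ⬝ᵥ kv A (X ^ l * s)) := by
      have e3 : A ^ l *ᵥ kv A h = kv A (X ^ l * h) := by rw [kv_mul]; simp
      rw [e3, dot_kv hA, show h * (X ^ l * h) = X ^ l * expand ℤ 2 h + C 2 * (X ^ l * s) by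
        rw [show h * (X ^ l * h) = X ^ l * (h * h) by ring, hs]; ring]
      rw [kv_add, kv_C_mul, dotProduct_add, dotProduct_smul, smul_eq_mul]
    have e4 : (2 : ℤ) ∣ onev n ⬝ᵥ kv A (X ^ l * s) := by
      apply kv_even hA hd
      rcases hs0 with hc | hc
      · exact Or.inl hc
      · right; rw [mul_coeff_zero, hc, mul_zero]
    have e5 := huAu l
    rw [e1, e2] at e5
    omega
  set E := expand ℤ 2 h with hE
  have hEdeg : E.degree < n := by
    by_cases hz : h = 0
    · rw [hE, hz, map_zero, degree_zero]; exact WithBot.bot_lt_coe n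
    · have hz' : E ≠ 0 := by
        rw [hE]; intro hh; exact hz ((expand_eq_zero (by norm_num)).1 hh)
      rw [← natDegree_lt_iff_degree_lt hz', hE, natDegree_expand]
      have := (natDegree_lt_iff_degree_lt hz).2 hdeg
      omega
  have hNy : Dv 2 (N *ᵥ fun i : Fin n => E.coeff i) := by
    intro l
    have e1 : ((walkMat A)ᵀ *ᵥ (walkMat A *ᵥ fun i : Fin n => E.coeff i)) l =
        onev n ⬝ᵥ kv A (X ^ (l : ℕ) * E) := by
      rw [kv_deg A E hEdeg, walk_transpose_mulVec, ← kv_X_pow, dot_kv hA]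
    rw [Matrix.mulVec_mulVec, hN, ← Matrix.mulVec_mulVec, mulVec_diagonal] at e1
    have e2 := hexp l
    rw [← e1] at e2
    unfold dfac at e2
    split_ifs at e2 <;> omega
  have hEc : ∀ i : Fin n, (2 : ℤ) ∣ E.coeff i := fun i =>
    (hp2.dvd_or_dvd (dvd_det_mul N 2 _ hNy i)).resolve_left hN2
  have hhc : C (2 : ℤ) ∣ h := by
    rw [C_dvd_iff_dvd_coeff]
    intro i
    have e : E.coeff (i * 2) = h.coeff i := coeff_expand_mul (by norm_num) h i
    rw [← e]
    by_cases hi : i * 2 < n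
    · exact hEc ⟨_, hi⟩
    · rw [degree_lt_iff_coeff_zero] at hEdeg
      rw [hEdeg _ (by omega)]; exact dvd_zero _
  obtain ⟨t, ht⟩ := hhc
  rw [hur, ht, kv_C_mul]
  exact (Dv_smul _ _).add (Dv_smul _ _)

lemma iso_of_P {n : ℕ} {G H : SimpleGraph (Fin n)} {P : Matrix (Fin n) (Fin n) ℤ}
    (h1 : adjMat n G * P = P * adjMat n H) (h2 : Pᵀ * P = 1) (h3 : P *ᵥ onev n = onev n) :
    Nonempty (G ≃g H) := by
  have h2' : P * Pᵀ = 1 := _root_.mul_eq_one_comm.1 h2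
  have hrow : ∀ i, ∑ j, P i j ^ 2 = 1 := by
    intro i
    have := congrFun (congrFun h2' i) i
    simpa [Matrix.mul_apply, pow_two] using this
  have hsum : ∀ i, ∑ j, P i j = 1 := by
    intro i
    have := congrFun h3 i
    simpa [Matrix.mulVec, dotProduct, onev] using this
  -- every entry is 0 or 1
  have h01 : ∀ i j, P i j = 0 ∨ P i j = 1 := by
    intro i j
    have e : ∑ j, (P i j ^ 2 - P i j) = 0 := by
      rw [Finset.sum_sub_distrib, hrow, hsum, sub_self]
    have nn : ∀ k ∈ Finset.univ, 0 ≤ P i k ^ 2 - P i k := by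
      intro k _
      rcases le_or_gt (P i k) 0 with hk | hk <;> nlinarith
    have := (Finset.sum_eq_zero_iff_of_nonneg nn).1 e j (Finset.mem_univ j)
    have : P i j * (P i j - 1) = 0 := by linarith
    rcases mul_eq_zero.1 this with h | h
    · exact Or.inl h
    · right; linarith
  have hex : ∀ i, ∃ j, P i j = 1 := by
    intro i
    by_contra hcon
    push Not at hcon
    have : ∑ j, P i j = 0 := Finset.sum_eq_zero fun j _ => (h01 i j).resolve_right (hcon j)
    rw [hsum] at this
    exact one_ne_zero this
  choose σ hσ using hex
  have hP : ∀ i j, P i j = if σ i = j then 1 else 0 := by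
    intro i j
    split_ifs with h
    · rw [← h]; exact hσ i
    · rcases h01 i j with h' | h'
      · exact h'
      · exfalso
        have hle : P i (σ i) + P i j ≤ ∑ k, P i k := by
          rw [← Finset.sum_pair (f := fun k => P i k) h]
          exact Finset.sum_le_sum_of_subset_of_nonneg (Finset.subset_univ _) fun k _ _ => by
            rcases h01 i k with h | h <;> rw [h] <;> norm_num
        rw [hsum, hσ, h'] at hle
        norm_num at hle
  have hinj : Function.Injective σ := by
    intro i i' hii
    by_contra hne
    have := congrFun (congrFun h2' i) i'
    rw [Matrix.mul_apply, Matrix.one_apply_ne hne] at this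
    simp [hP, hii] at this
  let τ : Fin n ≃ Fin n := Equiv.ofBijective σ (Finite.injective_iff_bijective.1 hinj)
  refine ⟨⟨τ, ?_⟩⟩
  intro a b
  have e := congrFun (congrFun h1 a) (σ b)
  have e1 : (adjMat n G * P) a (σ b) = adjMat n G a b := by
    rw [Matrix.mul_apply, Finset.sum_eq_single b]
    · simp [hP]
    · intro c _ hc
      rw [hP, if_neg fun h => hc (hinj h), mul_zero]
    · simp
  have e2 : (P * adjMat n H) a (σ b) = adjMat n H (σ a) (σ b) := by
    rw [Matrix.mul_apply]
    simp [hP]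
  rw [e1, e2] at e
  change H.Adj (σ a) (σ b) ↔ G.Adj a b
  simp only [adjMat, Matrix.of_apply] at e
  by_cases hg : G.Adj a b <;> by_cases hh : H.Adj (σ a) (σ b) <;> simp_all

lemma adjMat_symm {n : ℕ} (G : SimpleGraph (Fin n)) : (adjMat n G)ᵀ = adjMat n G := by
  ext i j
  simp [adjMat, G.adj_comm]

lemma adjMat_diag {n : ℕ} (G : SimpleGraph (Fin n)) (i : Fin n) : adjMat n G i i = 0 := by
  simp [adjMat]

/-- Wang's theorem: if `det W(G) / 2^⌊n/2⌋` is odd and square-free, then `G`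
is determined by its generalized spectrum. -/
theorem stmt0 (n : ℕ) (G : SimpleGraph (Fin n))
    (hodd : Odd ((walkMat (adjMat n G)).det / 2 ^ (n / 2)))
    (hsf : Squarefree ((walkMat (adjMat n G)).det / 2 ^ (n / 2))) :
    ∀ H : SimpleGraph (Fin n), genCospectral G H → Nonempty (G ≃g H) := by
  intro H hGH
  set A := adjMat n G with hAdef
  set B := adjMat n H with hBdef
  have hA : Aᵀ = A := adjMat_symm G
  have hB : Bᵀ = B := adjMat_symm H
  have hd : ∀ i, A i i = 0 := adjMat_diag G
  have haw : ∀ m, aw A m = aw B m := aw_eq_of_genCospectral hGH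
  have hc : A.charpoly = B.charpoly := hGH.1
  have hdA : (walkMat A).det ≠ 0 := by
    intro h
    rw [h] at hodd
    simp at hodd
  have hdB : (walkMat B).det ≠ 0 := by
    have hWW : (walkMat A)ᵀ * walkMat A = (walkMat B)ᵀ * walkMat B := by
      ext i j
      rw [WtW hA, WtW hB, haw]
    have := congrArg Matrix.det hWW
    rw [det_mul, det_mul, det_transpose, det_transpose] at this
    intro h
    rw [h, mul_zero] at this
    exact hdA (mul_self_eq_zero.1 this)
  -- the level
  have hex : ∃ l : ℕ, 0 < l ∧ ∃ P : Matrix (Fin n) (Fin n) ℤ,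
      P * walkMat B = (l : ℤ) • walkMat A := by
    refine ⟨((walkMat B).det ^ 2).natAbs, by positivity,
      (walkMat B).det • (walkMat A * (walkMat B).adjugate), ?_⟩
    rw [Matrix.smul_mul, Matrix.mul_assoc, adjugate_mul, Matrix.mul_smul, Matrix.mul_one, smul_smul,
      Int.natCast_natAbs, abs_of_nonneg (sq_nonneg _), pow_two]
  classical
  obtain ⟨hl, P, hP⟩ := Nat.find_spec hex
  have hmin := fun k => Nat.find_min (H := hex) (m := k)
  set l := Nat.find hex with hldef
  have hl0 : (l : ℤ) ≠ 0 := by exact_mod_cast hl.ne'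
  obtain ⟨f1, f2, f3, f4⟩ := P_facts hA hB haw hc hdB hl0 hP
  have hl1 : l = 1 := by
    by_contra hne
    obtain ⟨p, hp, hpl⟩ := Nat.exists_prime_and_dvd hne
    obtain ⟨k, hk⟩ := hpl
    have hpz : (p : ℤ) ≠ 0 := by exact_mod_cast hp.ne_zero
    -- every column of `P` is divisible by `p`
    have hcol : ∀ j, Dv p (fun i => P i j) := by
      intro j
      have hWP : (walkMat A)ᵀ * P = (l : ℤ) • (walkMat B)ᵀ := by
        have := congrArg Matrix.transpose f3
        simpa only [Matrix.transpose_mul, Matrix.transpose_transpose, Matrix.transpose_smul]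
          using this
      have hAl : ∀ t : ℕ, A ^ t * P = P * B ^ t := by
        intro t
        induction t with
        | zero => simp
        | succ t ih =>
          rw [pow_succ, Matrix.mul_assoc, f1, ← Matrix.mul_assoc, ih, Matrix.mul_assoc, ← pow_succ]
      have hu : Dv p ((walkMat A)ᵀ *ᵥ fun i => P i j) := by
        intro i
        have e : ((walkMat A)ᵀ *ᵥ fun i => P i j) i = ((walkMat A)ᵀ * P) i j := rfl
        rw [e, hWP, hk]
        exact ⟨k * (walkMat B)ᵀ i j, by simp [mul_assoc]⟩
      have hquad : ∀ t : ℕ, (p : ℤ) ^ 2 ∣ (fun i => P i j) ⬝ᵥ (A ^ t *ᵥ fun i => P i j) := by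
        intro t
        have e : (fun i => P i j) ⬝ᵥ (A ^ t *ᵥ fun i => P i j) = (Pᵀ * (A ^ t * P)) j j := rfl
        rw [e, hAl, ← Matrix.mul_assoc, f2, hk]
        exact ⟨k ^ 2 * (B ^ t) j j, by rw [Matrix.smul_mul, Matrix.one_mul, Matrix.smul_apply, smul_eq_mul]; push_cast; ring⟩
      rcases eq_or_ne p 2 with h2 | h2
      · subst h2
        exact two_case hA hd hodd _ hu (fun t => by simpa using hquad t)
      · refine odd_case hA p hp ?_ _ hu ?_ (by simpa using hquad 0) (by simpa using hquad 1)
        · intro hdvd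
          obtain ⟨m, hm⟩ := pow_dvd_det hA hd
          have h20 : (2 : ℤ) ^ (n / 2) ≠ 0 := pow_ne_zero _ two_ne_zero
          rw [hm, Int.mul_ediv_cancel_left _ h20] at hsf
          rw [hm] at hdvd
          have hpp : Prime (p : ℤ) := Nat.prime_iff_prime_int.1 hp
          have hnd : ¬ (p : ℤ) ∣ 2 ^ (n / 2) := by
            intro h
            have h3 := hpp.dvd_of_dvd_pow h
            have : p ∣ 2 := by exact_mod_cast h3
            exact h2 ((Nat.prime_dvd_prime_iff_eq hp Nat.prime_two).1 this)
          have h4 := hpp.pow_dvd_of_dvd_mul_left 2 hnd hdvd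
          rw [pow_two] at h4
          exact hpp.not_isUnit (hsf _ h4)
        · intro i
          have e : ((walkMat A)ᵀ *ᵥ (A *ᵥ fun i => P i j)) i =
            ((walkMat A)ᵀ * (A * P)) i j := rfl
          rw [e, f1, ← Matrix.mul_assoc, hWP, hk]
          exact ⟨k * ((walkMat B)ᵀ * B) i j, by rw [Matrix.smul_mul, Matrix.smul_apply, smul_eq_mul]; push_cast; ring⟩
    choose P' hP' using hcol
    have hPP : P = (p : ℤ) • Matrix.of fun i j => P' j i := by
      ext i j
      simpa using hP' j i
    have hkpos : 0 < k := by
      rcases Nat.eq_zero_or_pos k with h | h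
      · rw [h] at hk; omega
      · exact h
    have hkl : k < l := by
      rw [hk]; exact lt_mul_of_one_lt_left hkpos hp.one_lt
    refine hmin k hkl ⟨hkpos, Matrix.of fun i j => P' j i, ?_⟩
    apply smul_cancel hpz
    rw [← Matrix.smul_mul, ← hPP, hP, smul_smul, hk]
    push_cast
    rfl
  rw [hl1] at f2 f4
  exact iso_of_P f1 (by simpa using f2) (by simpa using f4)
end
end

section
/- Let G be a simple graph on n vertices with det W(G) ≠ 0, let p be an odd prime, and suppose rank_p W(G) = n−1. Let d_n be the n-th (largest) invariant factor of W(G). Then for every Q ∈ Q(G) with level ℓ, the integer d_n/p is an integer and ℓ divides d_n/p. -/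
open Matrix Polynomial
open scoped Classical

noncomputable section

/-- Membership in `Q(G)`: `Q` is a regular rational orthogonal matrix such that
`Qᵀ A Q` is a 0-1 matrix. -/
def inQSet {n : ℕ} (A : Matrix (Fin n) (Fin n) ℤ) (Q : Matrix (Fin n) (Fin n) ℚ) : Prop :=
  Qᵀ * Q = 1 ∧ (Q *ᵥ fun _ => (1 : ℚ)) = (fun _ => 1) ∧
  ∀ i j, (Qᵀ * A.map (Int.cast : ℤ → ℚ) * Q) i j = 0 ∨
         (Qᵀ * A.map (Int.cast : ℤ → ℚ) * Q) i j = 1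

/-- `ℓ` is the level of the rational matrix `Q`: the smallest positive integer `k`
such that `k • Q` is an integral matrix. -/
def IsLevel {n : ℕ} (Q : Matrix (Fin n) (Fin n) ℚ) (ℓ : ℕ) : Prop :=
  0 < ℓ ∧ (∀ i j, ∃ z : ℤ, (ℓ : ℚ) * Q i j = z) ∧
  ∀ k : ℕ, 0 < k → (∀ i j, ∃ z : ℤ, (k : ℚ) * Q i j = z) → ℓ ≤ k

/-- A square integral matrix is unimodular if its determinant is a unit (i.e. `±1`). -/
def IsUnimodular {n : ℕ} (U : Matrix (Fin n) (Fin n) ℤ) : Prop :=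
  IsUnit U.det

/-- `diag d` is the Smith normal form of `W`: `W = U (diag d) V` with `U, V` unimodular
and `d_i ∣ d_{i+1}`. -/
def IsSNF {n : ℕ} (W : Matrix (Fin n) (Fin n) ℤ) (d : Fin n → ℤ) : Prop :=
  (∃ U V : Matrix (Fin n) (Fin n) ℤ, IsUnimodular U ∧ IsUnimodular V ∧
    W = U * Matrix.diagonal d * V) ∧
  ∀ i j : Fin n, i ≤ j → d i ∣ d j

section fieldpart

variable {F : Type*} [Field F] {n : ℕ}

lemma aeval_mulVec_eig (A : Matrix (Fin n) (Fin n) F) (x : Fin n → F) (lam : F)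
    (hx : A *ᵥ x = lam • x) (f : F[X]) : (aeval A f) *ᵥ x = (f.eval lam) • x := by
  induction f using Polynomial.induction_on' with
  | add p q hp hq => simp [Matrix.add_mulVec, hp, hq, add_smul]
  | monomial k a =>
    have : ∀ k : ℕ, (A ^ k) *ᵥ x = lam ^ k • x := by
      intro k
      induction k with
      | zero => simp
      | succ k ih =>
        rw [pow_succ, ← Matrix.mulVec_mulVec, hx, Matrix.mulVec_smul, ih, smul_smul, pow_succ]
        congr 1; ring
    rw [aeval_monomial, Algebra.algebraMap_eq_smul_one, smul_mul_assoc, one_mul,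
      Matrix.smul_mulVec, this, eval_monomial, smul_smul]

lemma exists_dot_sep {m : ℕ} (S : Submodule F (Fin m → F)) (w : Fin m → F) (hw : w ∉ S) :
    ∃ v : Fin m → F, v ⬝ᵥ w ≠ 0 ∧ ∀ s ∈ S, v ⬝ᵥ s = 0 := by
  obtain ⟨f, hf, hS⟩ := Submodule.exists_le_ker_of_notMem hw
  refine ⟨fun i => f (Pi.single i 1), ?_, ?_⟩
  · have := LinearMap.pi_apply_eq_sum_univ f w
    intro h
    apply hf
    rw [this]
    refine Eq.trans ?_ h
    simp only [dotProduct, smul_eq_mul, mul_comm]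
    congr! 3
    ext k; simp [Pi.single_apply, eq_comm]
  · intro s hs
    have := LinearMap.pi_apply_eq_sum_univ f s
    have h0 : f s = 0 := hS hs
    rw [← h0, this]
    simp only [dotProduct, smul_eq_mul, mul_comm]
    congr! 3
    ext k; simp [Pi.single_apply, eq_comm]

lemma exists_dot_sep_prod {m : ℕ} (S : Submodule F ((Fin m → F) × F)) (w : (Fin m → F) × F)
    (hw : w ∉ S) :
    ∃ (v : Fin m → F) (t : F), v ⬝ᵥ w.1 + t * w.2 ≠ 0 ∧ ∀ s ∈ S, v ⬝ᵥ s.1 + t * s.2 = 0 := by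
  obtain ⟨f, hf, hS⟩ := Submodule.exists_le_ker_of_notMem hw
  have key : ∀ s : (Fin m → F) × F,
      (fun i => f (Pi.single i 1, 0)) ⬝ᵥ s.1 + f (0, 1) * s.2 = f s := by
    intro s
    have h1 := LinearMap.pi_apply_eq_sum_univ (f ∘ₗ LinearMap.inl F (Fin m → F) F) s.1
    have h2 : f (0, s.2) = f (0, 1) * s.2 := by
      have : ((0, s.2) : (Fin m → F) × F) = s.2 • (0, 1) := by simp
      rw [this, map_smul, smul_eq_mul, mul_comm]
    have h3 : s = (s.1, 0) + (0, s.2) := by simp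
    conv_rhs => rw [h3, map_add, h2]
    congr 1
    simp only [LinearMap.comp_apply, LinearMap.inl_apply] at h1
    rw [h1]
    simp only [dotProduct, smul_eq_mul, mul_comm]
    congr! 4
    ext k; simp [Pi.single_apply, eq_comm]
  refine ⟨fun i => f (Pi.single i 1, 0), f (0, 1), ?_, ?_⟩
  · rw [key]; exact hf
  · intro s hs
    rw [key]; exact hS hs

/-- Elements orthogonal to the kernel vector are polynomials in `A` applied to `e`. -/
lemma exists_poly (A : Matrix (Fin n) (Fin n) F) (e x u : Fin n → F)
    (hker : ∀ v : Fin n → F, (∀ j : ℕ, v ⬝ᵥ (A ^ j *ᵥ e) = 0) → ∃ r : F, v = r • x)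
    (hu : u ⬝ᵥ x = 0) : ∃ f : F[X], u = aeval A f *ᵥ e := by
  let L : F[X] →ₗ[F] (Fin n → F) :=
    { toFun := fun f => aeval A f *ᵥ e
      map_add' := by intro a b; simp [Matrix.add_mulVec]
      map_smul' := by intro a b; simp [Matrix.smul_mulVec] }
  by_contra hcon
  have hnot : u ∉ LinearMap.range L := by
    rintro ⟨f, hf⟩
    exact hcon ⟨f, hf.symm⟩
  obtain ⟨v, hv, hS⟩ := exists_dot_sep _ u hnot
  obtain ⟨r, rfl⟩ := hker v (by
    intro j
    have := hS (L (X ^ j)) ⟨_, rfl⟩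
    simpa [L] using this)
  apply hv
  rw [smul_dotProduct, dotProduct_comm, hu, smul_zero]

lemma field_lemma (A : Matrix (Fin n) (Fin n) F) (hA : Aᵀ = A) (e x b : Fin n → F) (lam c : F)
    (hx0 : x ≠ 0) (hx : A *ᵥ x = lam • x)
    (hker : ∀ v : Fin n → F, (∀ j : ℕ, v ⬝ᵥ (A ^ j *ᵥ e) = 0) → ∃ r : F, v = r • x)
    (hxx : x ⬝ᵥ x = 0) (hxb : x ⬝ᵥ b = 0) :
    ∃ (s : F) (y : Fin n → F), A *ᵥ y - lam • y - s • x + b = 0 ∧ e ⬝ᵥ y + c = 0 := by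
  let T : (F × (Fin n → F)) →ₗ[F] ((Fin n → F) × F) :=
    { toFun := fun q => (A *ᵥ q.2 - lam • q.2 - q.1 • x, e ⬝ᵥ q.2)
      map_add' := by
        intro a b
        ext
        · simp [Matrix.mulVec_add]; ring
        · simp
      map_smul' := by
        intro a b
        ext
        · simp [Matrix.mulVec_smul]; ring
        · simp }
  by_cases hmem : ((-b, -c) : (Fin n → F) × F) ∈ LinearMap.range T
  · obtain ⟨⟨s, y⟩, hsy⟩ := hmem
    refine ⟨s, y, ?_, ?_⟩
    · have := congrArg Prod.fst hsy
      simp only [T, LinearMap.coe_mk, AddHom.coe_mk] at this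
      rw [this]; simp
    · have := congrArg Prod.snd hsy
      simp only [T, LinearMap.coe_mk, AddHom.coe_mk] at this
      rw [this]; simp
  exfalso
  obtain ⟨u, t, hne, hz⟩ := exists_dot_sep_prod _ _ hmem
  have hux : u ⬝ᵥ x = 0 := by
    have := hz (T (1, 0)) ⟨_, rfl⟩
    simpa [T] using this
  have hAu : A *ᵥ u = lam • u - t • e := by
    have h1 : ∀ y : Fin n → F, (A *ᵥ u - lam • u + t • e) ⬝ᵥ y = 0 := by
      intro y
      have := hz (T (0, y)) ⟨_, rfl⟩
      simp only [T, LinearMap.coe_mk, AddHom.coe_mk, zero_smul, sub_zero] at this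
      rw [dotProduct_sub, Matrix.dotProduct_mulVec, ← Matrix.mulVec_transpose, hA,
        dotProduct_smul] at this
      rw [add_dotProduct, sub_dotProduct, smul_dotProduct, smul_dotProduct]
      simpa using this
    have h2 := (dotProduct_eq_zero_iff).mp h1
    have h3 : A *ᵥ u - (lam • u - t • e) = 0 := by rw [← h2]; abel
    exact sub_eq_zero.mp h3
  obtain ⟨g, hg⟩ := exists_poly A e x x hker hxx
  obtain ⟨f, hf⟩ := exists_poly A e x u hker hux
  have hcomm : ∀ (a b : F[X]) (v : Fin n → F),
      aeval A a *ᵥ (aeval A b *ᵥ v) = aeval A b *ᵥ (aeval A a *ᵥ v) := by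
    intro a b v
    rw [Matrix.mulVec_mulVec, Matrix.mulVec_mulVec, ← map_mul, ← map_mul, mul_comm]
  have ht : t = 0 := by
    by_contra ht
    apply hx0
    -- `t • x = g(A) (t e) = g(A) (lam - A) u = f(A) (lam - A) x = 0`
    have h1 : t • x = 0 := by
      have h2 : t • e = lam • u - A *ᵥ u := by rw [hAu]; abel
      calc t • x = aeval A g *ᵥ (t • e) := by rw [Matrix.mulVec_smul, ← hg]
        _ = aeval A g *ᵥ (aeval A (C lam - X) *ᵥ u) := by
            rw [h2]; simp [Matrix.sub_mulVec, Algebra.algebraMap_eq_smul_one, Matrix.smul_mulVec]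
        _ = aeval A (C lam - X) *ᵥ (aeval A f *ᵥ x) := by
            conv_lhs => rw [hf]
            rw [hcomm g, hcomm g f, ← hg]
        _ = aeval A f *ᵥ (aeval A (C lam - X) *ᵥ x) := hcomm _ _ _
        _ = 0 := by rw [aeval_mulVec_eig A x lam hx]; simp
    exact (smul_eq_zero.mp h1).resolve_left ht
  subst ht
  have hAu' : A *ᵥ u = lam • u := by rw [hAu]; simp
  have hg0 : g ≠ 0 := by
    rintro rfl
    apply hx0; rw [hg]; simp
  obtain ⟨r, hr⟩ : ∃ r : F, u = r • x := by
    have hfd : EuclideanDomain.gcd f g ∣ f := EuclideanDomain.gcd_dvd_left _ _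
    have hgd : EuclideanDomain.gcd f g ∣ g := EuclideanDomain.gcd_dvd_right _ _
    set d := EuclideanDomain.gcd f g with hd
    obtain ⟨f', hf'⟩ := hfd
    obtain ⟨g', hg'⟩ := hgd
    have hd0 : d ≠ 0 := by
      intro h; rw [h, zero_mul] at hg'; exact hg0 hg'
    have hcop : IsCoprime f' g' := by
      have h1 := EuclideanDomain.gcd_eq_gcd_ab f g
      rw [← hd] at h1
      refine ⟨EuclideanDomain.gcdA f g, EuclideanDomain.gcdB f g, mul_left_cancel₀ hd0 ?_⟩
      rw [mul_one]
      conv_rhs => rw [h1]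
      conv_rhs => rw [show f * EuclideanDomain.gcdA f g = (d * f') * EuclideanDomain.gcdA f g by rw [← hf'],
        show g * EuclideanDomain.gcdB f g = (d * g') * EuclideanDomain.gcdB f g by rw [← hg']]
      ring
    have hrel : f'.eval lam • x = g'.eval lam • u := by
      rw [← aeval_mulVec_eig A x lam hx, ← aeval_mulVec_eig A u lam hAu']
      conv_lhs => rw [hg]
      conv_rhs => rw [hf]
      rw [Matrix.mulVec_mulVec, Matrix.mulVec_mulVec, ← map_mul, ← map_mul]
      congr 2
      rw [hf', hg']
      ring
    by_cases h0 : g'.eval lam = 0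
    · exfalso
      rw [h0, zero_smul] at hrel
      have h1 : f'.eval lam = 0 := (smul_eq_zero.mp hrel).resolve_right hx0
      obtain ⟨a, b, hab⟩ := hcop
      have := congrArg (eval lam) hab
      simp [h0, h1] at this
    · refine ⟨(g'.eval lam)⁻¹ * f'.eval lam, ?_⟩
      rw [mul_smul, hrel, smul_smul, inv_mul_cancel₀ h0, one_smul]
  apply hne
  simp [hr, hxb]

end fieldpart

section intpart

variable {n : ℕ}

lemma level_dvd {Q : Matrix (Fin n) (Fin n) ℚ} {ℓ : ℕ} (h : IsLevel Q ℓ) (k : ℤ)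
    (hk : ∀ i j, ∃ z : ℤ, (k : ℚ) * Q i j = z) : (ℓ : ℤ) ∣ k := by
  obtain ⟨h0, h1, h2⟩ := h
  by_contra hnd
  have hl : (0 : ℤ) < ℓ := by exact_mod_cast h0
  have hr0 : 0 ≤ k % ℓ := Int.emod_nonneg _ hl.ne'
  have hr1 : k % ℓ < ℓ := Int.emod_lt_of_pos _ hl
  have hr2 : k % ℓ ≠ 0 := fun h => hnd (Int.dvd_of_emod_eq_zero h)
  obtain ⟨r, hr⟩ := Int.eq_ofNat_of_zero_le hr0
  have := h2 r (by omega) (by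
    intro i j
    obtain ⟨a, ha⟩ := hk i j
    obtain ⟨b, hb⟩ := h1 i j
    refine ⟨a - b * (k / ℓ), ?_⟩
    have e1 : (r : ℚ) = k - ℓ * ((k / ℓ : ℤ) : ℚ) := by
      have : (r : ℤ) = k - ℓ * (k / ℓ) := by rw [← hr, Int.emod_def]
      exact_mod_cast this
    rw [e1]; push_cast; rw [← ha, ← hb]; ring)
  omega

/-- consequences of the Smith normal form -/
lemma snf_cons (W : Matrix (Fin n) (Fin n) ℤ) (d : Fin n → ℤ) (h : IsSNF W d) (p : ℕ)
    (hp : p.Prime) (hdet : W.det ≠ 0) (l : Fin n) (hl : ∀ i, i ≤ l)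
    (hrank : (W.map (Int.cast : ℤ → ZMod p)).rank = n - 1) :
    d l ≠ 0 ∧ (p : ℤ) ∣ d l ∧ (∃ P : Matrix (Fin n) (Fin n) ℤ, P * Wᵀ = d l • (1 : Matrix _ _ ℤ)) ∧
    (∃ z : Fin n → ℤ, ∀ (m : ℕ) (x v : Fin n → ℤ), Wᵀ *ᵥ x = ((p : ℤ) ^ m) • v →
      ∃ (c : ℤ) (w : Fin n → ℤ), x = c • z + ((p : ℤ) ^ m) • w) ∧
    (∀ (k : ℕ) (x v : Fin n → ℤ), Wᵀ *ᵥ x = ((p : ℤ) ^ (k + 1)) • v → ¬ (p : ℤ) ^ (k + 1) ∣ d l →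
      ∃ w : Fin n → ℤ, x = (p : ℤ) • w) := by
  have : Fact p.Prime := ⟨hp⟩
  have hpZ : Prime (p : ℤ) := Nat.prime_iff_prime_int.mp hp
  obtain ⟨⟨U, V, hU, hV, hW⟩, hd⟩ := h
  have hd0 : ∀ i, d i ≠ 0 := by
    have : (U * Matrix.diagonal d * V).det ≠ 0 := by rw [← hW]; exact hdet
    rw [det_mul, det_mul, det_diagonal] at this
    intro i hi
    apply this
    rw [Finset.prod_eq_zero (Finset.mem_univ i) hi]; simp
  -- rank
  have hcard : Fintype.card {i // ((d i : ℤ) : ZMod p) ≠ 0} = n - 1 := by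
    rw [← hrank, ← Matrix.rank_diagonal]
    have : W.map (Int.cast : ℤ → ZMod p) =
        U.map (Int.cast : ℤ → ZMod p) * Matrix.diagonal (fun i => ((d i : ℤ) : ZMod p)) *
          V.map (Int.cast : ℤ → ZMod p) := by
      rw [hW]
      have := Matrix.map_mul (L := U * Matrix.diagonal d) (M := V) (f := Int.castRingHom (ZMod p))
      have h2 := Matrix.map_mul (L := U) (M := Matrix.diagonal d) (f := Int.castRingHom (ZMod p))
      rw [h2] at this
      simp only [Int.coe_castRingHom] at this
      rw [this, Matrix.diagonal_map (by simp)]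
    have hu : ∀ U : Matrix (Fin n) (Fin n) ℤ, IsUnimodular U →
        IsUnit (U.map (Int.cast : ℤ → ZMod p)).det := by
      intro U hU
      have h1 := (hU : IsUnit U.det).map (Int.castRingHom (ZMod p))
      rw [RingHom.map_det] at h1
      exact h1
    rw [this, Matrix.rank_mul_eq_left_of_isUnit_det _ _ (hu V hV),
      Matrix.rank_mul_eq_right_of_isUnit_det _ _ (hu U hU)]
  have hn : 0 < n := l.pos
  have hcard2 : Fintype.card {i // ¬ ((d i : ℤ) : ZMod p) ≠ 0} = 1 := by
    rw [Fintype.card_subtype_compl, hcard, Fintype.card_fin]; omega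
  obtain ⟨⟨i0, hi0⟩, huniq⟩ := Fintype.card_eq_one_iff.mp hcard2
  have hpi0 : (p : ℤ) ∣ d i0 := by
    rw [← ZMod.intCast_zmod_eq_zero_iff_dvd]
    simpa using hi0
  have hpl : (p : ℤ) ∣ d l := hpi0.trans (hd _ _ (hl i0))
  have huniq' : ∀ i, (p : ℤ) ∣ d i → i = i0 := by
    intro i hi
    have := huniq ⟨i, by
      rw [← ZMod.intCast_zmod_eq_zero_iff_dvd] at hi
      simpa using hi⟩
    exact congrArg Subtype.val this
  have hli0 : l = i0 := huniq' l hpl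
  have hnd : ∀ i, i ≠ l → ¬ (p : ℤ) ∣ d i := by
    intro i hi h
    exact hi ((huniq' i h).trans hli0.symm)
  -- inverses
  have hUU : U * U⁻¹ = 1 := Matrix.mul_nonsing_inv _ hU
  have hVV : V * V⁻¹ = 1 := Matrix.mul_nonsing_inv _ hV
  have hUt : (U⁻¹)ᵀ * Uᵀ = 1 := by rw [← transpose_mul, hUU, transpose_one]
  have hVt : (V⁻¹)ᵀ * Vᵀ = 1 := by rw [← transpose_mul, hVV, transpose_one]
  have hWt : Wᵀ = Vᵀ * (Matrix.diagonal d * Uᵀ) := by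
    rw [hW, transpose_mul, transpose_mul, diagonal_transpose]
  have hfund : ∀ x v : Fin n → ℤ, ∀ a : ℤ, Wᵀ *ᵥ x = a • v →
      ∀ i, a ∣ d i * (Uᵀ *ᵥ x) i := by
    intro x v a hx i
    have h1 : (V⁻¹)ᵀ *ᵥ (Wᵀ *ᵥ x) = Matrix.diagonal d *ᵥ (Uᵀ *ᵥ x) := by
      rw [hWt, mulVec_mulVec, ← Matrix.mul_assoc, hVt, Matrix.one_mul, mulVec_mulVec]
    rw [hx, mulVec_smul] at h1
    have h2 := congrFun h1 i
    rw [mulVec_diagonal] at h2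
    rw [← h2]
    exact ⟨_, rfl⟩
  have hxU : ∀ x : Fin n → ℤ, x = (U⁻¹)ᵀ *ᵥ (Uᵀ *ᵥ x) := by
    intro x; rw [mulVec_mulVec, hUt, one_mulVec]
  have hother : ∀ x v : Fin n → ℤ, ∀ m : ℕ, Wᵀ *ᵥ x = ((p : ℤ) ^ m) • v →
      ∀ i, i ≠ l → (p : ℤ) ^ m ∣ (Uᵀ *ᵥ x) i := by
    intro x v m hx i hi
    have hco : IsCoprime ((p : ℤ) ^ m) (d i) :=
      ((Prime.coprime_iff_not_dvd hpZ).mpr (hnd i hi)).pow_left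
    exact hco.dvd_of_dvd_mul_left (hfund x v _ hx i)
  refine ⟨hd0 l, hpl, ?_, ?_, ?_⟩
  · choose c hc using fun i => hd i l (hl i)
    refine ⟨(U⁻¹)ᵀ * (Matrix.diagonal c * (V⁻¹)ᵀ), ?_⟩
    have h1 : Matrix.diagonal c * Matrix.diagonal d = d l • (1 : Matrix (Fin n) (Fin n) ℤ) := by
      rw [diagonal_mul_diagonal, smul_one_eq_diagonal]
      congr 1; ext i; rw [hc i, mul_comm]
    calc (U⁻¹)ᵀ * (Matrix.diagonal c * (V⁻¹)ᵀ) * Wᵀ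
        = (U⁻¹)ᵀ * (Matrix.diagonal c * (((V⁻¹)ᵀ * Vᵀ) * (Matrix.diagonal d * Uᵀ))) := by
          rw [hWt]; simp only [Matrix.mul_assoc]
      _ = (U⁻¹)ᵀ * ((Matrix.diagonal c * Matrix.diagonal d) * Uᵀ) := by
          rw [hVt, Matrix.one_mul, Matrix.mul_assoc]
      _ = d l • 1 := by
          rw [h1, smul_mul_assoc, Matrix.one_mul, Matrix.mul_smul, hUt]
  · refine ⟨(U⁻¹)ᵀ *ᵥ Pi.single l 1, ?_⟩
    intro m x v hx
    have h1 := hother x v m hx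
    have h2 : ∃ w : Fin n → ℤ, Uᵀ *ᵥ x = (Uᵀ *ᵥ x) l • Pi.single l 1 + ((p : ℤ) ^ m) • w := by
      choose! w hw using h1
      refine ⟨fun i => if i = l then 0 else w i, ?_⟩
      ext i
      by_cases hi : i = l
      · subst hi; simp
      · simp [hi, hw i hi]
    obtain ⟨w, hw⟩ := h2
    refine ⟨(Uᵀ *ᵥ x) l, (U⁻¹)ᵀ *ᵥ w, ?_⟩
    rw [← mulVec_smul, ← mulVec_smul, ← mulVec_add, ← hw]
    exact hxU x
  · intro k x v hx hnk
    have h1 : ∀ i, (p : ℤ) ∣ (Uᵀ *ᵥ x) i := by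
      intro i
      by_cases hi : i = l
      · subst hi
        by_contra hcon
        apply hnk
        have hco : IsCoprime ((p : ℤ) ^ (k + 1)) ((Uᵀ *ᵥ x) i) :=
          ((Prime.coprime_iff_not_dvd hpZ).mpr hcon).pow_left
        exact hco.dvd_of_dvd_mul_right (hfund x v _ hx i)
      · exact (dvd_pow_self _ (Nat.succ_ne_zero k)).trans (hother x v _ hx i hi)
    choose w hw using h1
    refine ⟨(U⁻¹)ᵀ *ᵥ w, ?_⟩
    rw [← mulVec_smul]
    have : (p : ℤ) • w = Uᵀ *ᵥ x := by ext i; simp [hw i]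
    rw [this]
    exact hxU x

end intpart

section corepart

variable {n : ℕ}

lemma walk_mulVec (A : Matrix (Fin n) (Fin n) ℤ) (x : Fin n → ℤ) (j : Fin n) :
    ((walkMat A)ᵀ *ᵥ x) j = x ⬝ᵥ (A ^ (j : ℕ) *ᵥ fun _ => (1 : ℤ)) := by
  rw [dotProduct_comm]
  rfl

lemma core (A : Matrix (Fin n) (Fin n) ℤ) (hA : Aᵀ = A) (p : ℕ) (hp : p.Prime) (k : ℕ)
    (hk : 1 ≤ k) (q b : Fin n → ℤ) (lam c : ℤ)
    (hAq : A *ᵥ q = lam • q + ((p : ℤ) ^ k) • b)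
    (heq : (fun _ => (1 : ℤ)) ⬝ᵥ q = (p : ℤ) ^ k * c)
    (hqq : (p : ℤ) ∣ q ⬝ᵥ q) (hqb : (p : ℤ) ∣ q ⬝ᵥ b)
    (hq : ¬ ∃ w : Fin n → ℤ, q = (p : ℤ) • w)
    (hker : ∀ v : Fin n → ℤ, (∀ j : ℕ, (p : ℤ) ∣ v ⬝ᵥ (A ^ j *ᵥ fun _ => (1 : ℤ))) →
      ∃ (r : ℤ) (w : Fin n → ℤ), v = r • q + (p : ℤ) • w) :
    ∃ y v : Fin n → ℤ,
      (walkMat A)ᵀ *ᵥ (q + ((p : ℤ) ^ k) • y) = ((p : ℤ) ^ (k + 1)) • v := by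
  have : Fact p.Prime := ⟨hp⟩
  set φ : ℤ →+* ZMod p := Int.castRingHom (ZMod p) with hφ
  have hz : ∀ a : ℤ, φ a = 0 ↔ (p : ℤ) ∣ a := fun a => ZMod.intCast_zmod_eq_zero_iff_dvd a p
  have hpp : φ (p : ℤ) = 0 := (hz _).mpr dvd_rfl
  have hpk : φ ((p : ℤ) ^ k) = 0 := (hz _).mpr (dvd_pow_self _ (by omega))
  have hsurj : ∀ v : Fin n → ZMod p, ∃ v' : Fin n → ℤ, v = φ ∘ v' := by
    intro v
    choose v' hv' using fun i => ZMod.intCast_surjective (v i)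
    exact ⟨v', by ext i; exact (hv' i).symm⟩
  have hmv : ∀ (M : Matrix (Fin n) (Fin n) ℤ) (v : Fin n → ℤ),
      φ.mapMatrix M *ᵥ (φ ∘ v) = φ ∘ (M *ᵥ v) := by
    intro M v
    ext i
    simp only [Function.comp_apply, RingHom.map_mulVec]
    rfl
  have hdp : ∀ v w : Fin n → ℤ, (φ ∘ v) ⬝ᵥ (φ ∘ w) = φ (v ⬝ᵥ w) := by
    intro v w
    exact (RingHom.map_dotProduct φ v w).symm
  have hone : (φ ∘ fun _ : Fin n => (1 : ℤ)) = fun _ => 1 := by ext i; simp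
  obtain ⟨s, y, h1, h2⟩ := field_lemma (φ.mapMatrix A)
    (by ext i j; simpa using congrArg φ (congrFun (congrFun hA i) j))
    (φ ∘ fun _ => (1 : ℤ)) (φ ∘ q) (φ ∘ b) (φ lam) (φ c)
    (by
      intro h
      apply hq
      choose w hw using fun i => (hz (q i)).mp (congrFun h i)
      exact ⟨w, by ext i; simp [hw i]⟩)
    (by
      rw [hmv, hAq]
      ext i
      simp [hpk, -map_pow, -map_natCast, -eq_intCast])
    (by
      intro v hv
      obtain ⟨v, rfl⟩ := hsurj v
      obtain ⟨r, w, hw⟩ := hker v (by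
        intro j
        rw [← hz, ← hdp, ← hmv, map_pow]
        exact hv j)
      refine ⟨φ r, ?_⟩
      ext i
      rw [hw]
      simp only [Function.comp_apply, Pi.add_apply, Pi.smul_apply, smul_eq_mul, map_add, map_mul,
        hpp, zero_mul, add_zero])
    (by rw [hdp]; exact (hz _).mpr hqq)
    (by rw [hdp]; exact (hz _).mpr hqb)
  obtain ⟨s, rfl⟩ : ∃ s' : ℤ, φ s' = s := ZMod.intCast_surjective s
  obtain ⟨y, rfl⟩ := hsurj y
  rw [hdp, ← map_add, hz] at h2
  rw [hmv] at h1
  have h3 : ∀ i, (p : ℤ) ∣ (A *ᵥ y) i - lam * y i - s * q i + b i := by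
    intro i
    rw [← hz]
    have := congrFun h1 i
    simpa only [Pi.add_apply, Pi.sub_apply, Pi.smul_apply, smul_eq_mul, Function.comp_apply,
      Pi.zero_apply, ← map_mul, ← map_sub, ← map_add] using this
  choose g hg using h3
  obtain ⟨c', hc'⟩ := h2
  obtain ⟨m, rfl⟩ : ∃ m, k = m + 1 := ⟨k - 1, by omega⟩
  set P : ℤ := (p : ℤ) with hP
  set x : Fin n → ℤ := q + (P ^ (m + 1)) • y with hx
  set e : Fin n → ℤ := fun _ => (1 : ℤ) with he
  have hAx : ∃ t : Fin n → ℤ, A *ᵥ x = (lam + P ^ (m + 1) * s) • x + (P ^ (m + 1 + 1)) • t := by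
    refine ⟨fun i => g i - P ^ m * s * y i, ?_⟩
    rw [hx, mulVec_add, mulVec_smul, hAq]
    ext i
    simp only [Pi.add_apply, Pi.smul_apply, smul_eq_mul]
    have := hg i
    linear_combination P ^ (m + 1) * this
  obtain ⟨t, ht⟩ := hAx
  have hex : e ⬝ᵥ x = P ^ (m + 1 + 1) * c' := by
    rw [hx, dotProduct_add, dotProduct_smul, heq, smul_eq_mul]
    linear_combination P ^ (m + 1) * hc'
  have hpow : ∀ j : ℕ, ∃ tj : Fin n → ℤ,
      A ^ j *ᵥ x = ((lam + P ^ (m + 1) * s) ^ j) • x + (P ^ (m + 1 + 1)) • tj := by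
    intro j
    induction j with
    | zero => exact ⟨0, by simp⟩
    | succ j ih =>
      obtain ⟨tj, htj⟩ := ih
      refine ⟨(lam + P ^ (m + 1) * s) ^ j • t + A *ᵥ tj, ?_⟩
      rw [pow_succ', ← mulVec_mulVec, htj, mulVec_add, mulVec_smul, mulVec_smul, ht]
      ext i
      simp only [Pi.add_apply, Pi.smul_apply, smul_eq_mul]
      ring
  choose tj htj using hpow
  refine ⟨y, fun j => (lam + P ^ (m + 1) * s) ^ (j : ℕ) * c' + e ⬝ᵥ tj j, ?_⟩
  ext j
  rw [walk_mulVec]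
  have hsymm : (A ^ (j : ℕ))ᵀ = A ^ (j : ℕ) := by rw [transpose_pow, hA]
  rw [dotProduct_mulVec, ← mulVec_transpose, hsymm, htj, dotProduct_comm, dotProduct_add,
    dotProduct_smul, dotProduct_smul, hex]
  simp only [Pi.smul_apply, smul_eq_mul]
  ring

end corepart

/-- for an odd prime `p`, if `det W(G) ≠ 0` and `rank_p W(G) = n - 1`, then
`p ∣ d_n` and every `Q ∈ Q(G)` with level `ℓ` satisfies `ℓ ∣ d_n / p`. -/
theorem stmt1 (n : ℕ) (hn : 0 < n) (G : SimpleGraph (Fin n)) (p : ℕ)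
    (hp : p.Prime) (hpodd : Odd p)
    (hdet : (walkMat (adjMat n G)).det ≠ 0)
    (hrank : ((walkMat (adjMat n G)).map (Int.cast : ℤ → ZMod p)).rank = n - 1)
    (d : Fin n → ℤ) (hSNF : IsSNF (walkMat (adjMat n G)) d)
    (Q : Matrix (Fin n) (Fin n) ℚ) (hQ : inQSet (adjMat n G) Q)
    (ℓ : ℕ) (hℓ : IsLevel Q ℓ) :
    (p : ℤ) ∣ d ⟨n - 1, Nat.sub_lt hn Nat.one_pos⟩ ∧
    (ℓ : ℤ) ∣ d ⟨n - 1, Nat.sub_lt hn Nat.one_pos⟩ / (p : ℤ) := by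
  have hA : (adjMat n G)ᵀ = adjMat n G := by
    ext i j
    simp [adjMat, G.adj_comm]
  set A := adjMat n G with hAdef
  set l : Fin n := ⟨n - 1, Nat.sub_lt hn Nat.one_pos⟩ with hl
  obtain ⟨hd0, hpd, ⟨P, hP⟩, ⟨z, hz⟩, hlast⟩ := snf_cons (walkMat A) d hSNF p hp hdet l
    (by intro i; rw [Fin.le_def]; have := i.2; simp only [hl]; omega) hrank
  refine ⟨hpd, ?_⟩
  have hpZ : Prime (p : ℤ) := Nat.prime_iff_prime_int.mp hp
  have hp0 : (p : ℤ) ≠ 0 := hpZ.ne_zero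
  obtain ⟨hQQ, hQe, hB01⟩ := hQ
  have hQQ' : Q * Qᵀ = 1 := mul_eq_one_comm.mp hQQ
  have hB : ∀ i j, ∃ b : ℤ, (Qᵀ * A.map (Int.cast : ℤ → ℚ) * Q) i j = b := by
    intro i j
    rcases hB01 i j with h | h
    · exact ⟨0, by rw [h]; simp⟩
    · exact ⟨1, by rw [h]; simp⟩
  choose B hB using hB
  choose N hN using hℓ.2.1
  have hl0 : (ℓ : ℚ) ≠ 0 := by exact_mod_cast hℓ.1.ne'
  let ψ := (Int.castRingHom ℚ)
  let B' : Matrix (Fin n) (Fin n) ℤ := Matrix.of B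
  let N' : Matrix (Fin n) (Fin n) ℤ := Matrix.of N
  have hinj : Function.Injective (ψ.mapMatrix : Matrix (Fin n) (Fin n) ℤ →+* _) := by
    intro M1 M2 h
    ext i j
    have := congrFun (congrFun h i) j
    simpa [ψ] using this
  have hBm : ψ.mapMatrix B' = Qᵀ * ψ.mapMatrix A * Q := by
    ext i j; exact (hB i j).symm
  have hNm : ψ.mapMatrix N' = (ℓ : ℚ) • Q := by
    ext i j; exact (hN i j).symm
  have htr : ∀ M : Matrix (Fin n) (Fin n) ℤ, ψ.mapMatrix Mᵀ = (ψ.mapMatrix M)ᵀ := fun M => rfl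
  have hAN : A * N' = N' * B' := by
    apply hinj
    rw [map_mul, map_mul, hNm, hBm, smul_mul_assoc, mul_smul_comm, Matrix.mul_assoc,
      ← Matrix.mul_assoc Q, hQQ', Matrix.one_mul]
  have hNN : N'ᵀ * N' = ((ℓ : ℤ) ^ 2) • (1 : Matrix (Fin n) (Fin n) ℤ) := by
    apply hinj
    rw [map_mul, htr, hNm, transpose_smul, smul_mul_assoc, mul_smul_comm, hQQ, smul_smul, ← sq]
    ext i j
    simp only [RingHom.mapMatrix_apply, Matrix.map_apply, Matrix.smul_apply, smul_eq_mul, map_mul]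
    by_cases h : i = j
    · subst h; simp [ψ]
    · simp [h]
  have hNAN : N'ᵀ * (A * N') = ((ℓ : ℤ) ^ 2) • B' := by
    rw [hAN, ← Matrix.mul_assoc, hNN, smul_mul_assoc, Matrix.one_mul]
  have hNe : N'ᵀ *ᵥ (fun _ => (1 : ℤ)) = (ℓ : ℤ) • fun _ => (1 : ℤ) := by
    have h1 : Qᵀ *ᵥ (fun _ => (1 : ℚ)) = fun _ => 1 := by
      conv_lhs => rw [← hQe]
      rw [mulVec_mulVec, hQQ, one_mulVec]
    ext i
    have h2 := congrFun h1 i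
    simp only [mulVec, dotProduct, transpose_apply, mul_one] at h2
    have h3 : ((∑ j, N' j i : ℤ) : ℚ) = ℓ := by
      push_cast
      calc (∑ j, (N' j i : ℚ)) = ∑ j, (ℓ : ℚ) * Q j i := by
            apply Finset.sum_congr rfl; intro j _; exact (hN j i).symm
        _ = ℓ := by rw [← Finset.mul_sum, h2, mul_one]
    simp only [mulVec, dotProduct, transpose_apply, mul_one, Pi.smul_apply, smul_eq_mul]
    exact_mod_cast h3
  have hNA : N'ᵀ * A = B'ᵀ * N'ᵀ := by
    rw [← transpose_mul, ← hAN, transpose_mul, hA]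
  have hNAj : ∀ j : ℕ, N'ᵀ * A ^ j = B'ᵀ ^ j * N'ᵀ := by
    intro j
    induction j with
    | zero => simp
    | succ j ih => rw [pow_succ, ← Matrix.mul_assoc, ih, Matrix.mul_assoc, hNA, ← Matrix.mul_assoc,
        ← pow_succ]
  have hNW : ∀ (j : ℕ) (i : Fin n), (fun a => N' a i) ⬝ᵥ (A ^ j *ᵥ fun _ => (1 : ℤ)) =
      ℓ * (B'ᵀ ^ j *ᵥ fun _ => (1 : ℤ)) i := by
    intro j i
    have h1 : N'ᵀ *ᵥ (A ^ j *ᵥ fun _ => (1 : ℤ)) = (ℓ : ℤ) • (B'ᵀ ^ j *ᵥ fun _ => (1 : ℤ)) := by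
      rw [mulVec_mulVec, hNAj, ← mulVec_mulVec, hNe, mulVec_smul]
    exact congrFun h1 i
  have hWN : (walkMat A)ᵀ * N' = (ℓ : ℤ) • (walkMat B'ᵀ)ᵀ := by
    ext j i
    have h1 := walk_mulVec A (fun a => N' a i) j
    rw [hNW] at h1
    exact h1
  -- the level divides `d_n`
  have hld : (ℓ : ℤ) ∣ d l := by
    apply level_dvd hℓ
    intro i j
    refine ⟨(P * (walkMat B'ᵀ)ᵀ) i j, ?_⟩
    have h1 : d l • N' = (ℓ : ℤ) • (P * (walkMat B'ᵀ)ᵀ) := by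
      rw [← mul_smul_comm, ← hWN, ← Matrix.mul_assoc, hP, smul_mul_assoc, Matrix.one_mul]
    have h2 := congrFun (congrFun h1 i) j
    simp only [Matrix.smul_apply, smul_eq_mul] at h2
    have h3 : (d l : ℚ) * N' i j = ℓ * ((P * (walkMat B'ᵀ)ᵀ) i j : ℤ) := by exact_mod_cast h2
    have h4 : (N' i j : ℚ) = ℓ * Q i j := (hN i j).symm
    rw [h4] at h3
    apply mul_left_cancel₀ hl0
    rw [← h3]; ring
  obtain ⟨m, hm⟩ := hld
  by_cases hpm : (p : ℤ) ∣ m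
  · obtain ⟨m', rfl⟩ := hpm
    refine ⟨m', ?_⟩
    rw [hm]
    apply Int.ediv_eq_of_eq_mul_right hp0
    ring
  exfalso
  -- the exact power of `p`
  have hfin : FiniteMultiplicity (p : ℤ) (d l) := by
    rw [Int.finiteMultiplicity_iff]
    exact ⟨by simpa using hp.ne_one, hd0⟩
  obtain ⟨k, hkd, hkn⟩ : ∃ k, (p : ℤ) ^ k ∣ d l ∧ ¬ (p : ℤ) ^ (k + 1) ∣ d l :=
    ⟨multiplicity (p : ℤ) (d l), pow_multiplicity_dvd _ _,
      hfin.not_pow_dvd_of_multiplicity_lt (Nat.lt_succ_self _)⟩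
  have hk : 1 ≤ k := by
    by_contra h
    have : k = 0 := by omega
    subst this
    apply hkn; simpa using hpd
  have hkl : (p : ℤ) ^ k ∣ ℓ := by
    rw [hm] at hkd
    exact (((Prime.coprime_iff_not_dvd hpZ).mpr hpm).pow_left).dvd_of_dvd_mul_right hkd
  obtain ⟨L, hL⟩ := hkl
  -- all columns are multiples of `z` modulo `p ^ k`
  have hcol : ∀ i, ∃ (c : ℤ) (w : Fin n → ℤ), (fun a => N' a i) = c • z + ((p : ℤ) ^ k) • w := by
    intro i
    apply hz k _ (fun j => L * (B'ᵀ ^ (j : ℕ) *ᵥ fun _ => (1 : ℤ)) i)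
    ext j
    rw [walk_mulVec, hNW, hL]
    simp only [Pi.smul_apply, smul_eq_mul]
    ring
  choose c w hcw using hcol
  -- some column is nonzero mod `p`
  obtain ⟨i, hi⟩ : ∃ i, ¬ ∃ v : Fin n → ℤ, (fun a => N' a i) = (p : ℤ) • v := by
    by_contra hcon
    push Not at hcon
    choose v hv using hcon
    have hpl : (p : ℤ) ∣ ℓ := by rw [hL]; exact (dvd_pow_self _ (by omega)).mul_right _
    obtain ⟨L', hL'⟩ := hpl
    have h1 : (ℓ : ℤ) ∣ L' := by
      apply level_dvd hℓ
      intro a b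
      refine ⟨v b a, ?_⟩
      have h2 : N a b = p * v b a := congrFun (hv b) a
      have h3 := hN a b
      rw [h2] at h3
      have h4 : (ℓ : ℚ) = p * L' := by exact_mod_cast hL'
      rw [h4] at h3
      have hpq : (p : ℚ) ≠ 0 := by exact_mod_cast hp.ne_zero
      apply mul_left_cancel₀ hpq
      push_cast at h3
      linarith
    obtain ⟨t, ht⟩ := h1
    have hlz : (ℓ : ℤ) ≠ 0 := by exact_mod_cast hℓ.1.ne'
    have h2 : (ℓ : ℤ) * (p * t) = ℓ * 1 := by
      rw [mul_one]; conv_rhs => rw [hL', ht]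
      ring
    have h3 := mul_left_cancel₀ hlz h2
    exact hpZ.not_isUnit (IsUnit.of_mul_eq_one _ h3)
  set q : Fin n → ℤ := fun a => N' a i with hq
  have hci : ¬ (p : ℤ) ∣ c i := by
    rintro ⟨c', hc'⟩
    obtain ⟨k', rfl⟩ : ∃ k', k = k' + 1 := ⟨k - 1, by omega⟩
    apply hi
    refine ⟨c' • z + ((p : ℤ) ^ k') • w i, ?_⟩
    rw [hq, hcw i, hc', smul_add, smul_smul, smul_smul, pow_succ']
  obtain ⟨a, b, hab⟩ : IsCoprime ((p : ℤ) ^ k) (c i) :=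
    ((Prime.coprime_iff_not_dvd hpZ).mpr hci).pow_left
  have hzq : z = b • q + ((p : ℤ) ^ k) • (a • z - b • w i) := by
    rw [hq, hcw i]
    ext t
    simp only [Pi.add_apply, Pi.sub_apply, Pi.smul_apply, smul_eq_mul]
    linear_combination (- z t) * hab
  set z' : Fin n → ℤ := a • z - b • w i with hz'
  obtain ⟨lam, β, hAq⟩ : ∃ (lam : ℤ) (β : Fin n → ℤ), A *ᵥ q = lam • q + ((p : ℤ) ^ k) • β := by
    refine ⟨(∑ j, c j * B' j i) * b, (∑ j, c j * B' j i) • z' + ∑ j, B' j i • w j, ?_⟩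
    ext t
    have h1 : (A *ᵥ q) t = ∑ j, N' t j * B' j i := by
      have := congrFun (congrFun hAN t) i
      exact this
    rw [h1]
    have h2 : ∀ j, N' t j = c j * z t + (p : ℤ) ^ k * w j t := fun j => congrFun (hcw j) t
    have h3 : z t = b * q t + (p : ℤ) ^ k * z' t := congrFun hzq t
    have h4 : ∑ j, N' t j * B' j i =
        (∑ j, c j * B' j i) * z t + (p : ℤ) ^ k * ∑ j, B' j i * w j t := by
      rw [Finset.sum_mul, Finset.mul_sum, ← Finset.sum_add_distrib]
      apply Finset.sum_congr rfl
      intro j _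
      rw [h2]; ring
    rw [h4, h3]
    simp only [Pi.add_apply, Pi.smul_apply, smul_eq_mul, Finset.sum_apply]
    ring
  have hqq : q ⬝ᵥ q = (ℓ : ℤ) ^ 2 := by
    have := congrFun (congrFun hNN i) i
    simp only [Matrix.smul_apply, Matrix.one_apply_eq, smul_eq_mul, mul_one] at this
    exact this
  have hqAq : q ⬝ᵥ (A *ᵥ q) = (ℓ : ℤ) ^ 2 * B' i i := congrFun (congrFun hNAN i) i
  have hpl : (p : ℤ) ∣ ℓ := by rw [hL]; exact (dvd_pow_self _ (by omega)).mul_right _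
  have hqb : (p : ℤ) ∣ q ⬝ᵥ β := by
    rw [hAq, dotProduct_add, dotProduct_smul, dotProduct_smul, hqq, smul_eq_mul, smul_eq_mul] at hqAq
    have h1 : (p : ℤ) ^ k * (q ⬝ᵥ β) = (p : ℤ) ^ k * (ℓ * (L * (B' i i - lam))) := by
      linear_combination hqAq + (ℓ * B' i i - ℓ * lam) * hL
    rw [mul_left_cancel₀ (pow_ne_zero k hp0) h1]
    exact hpl.mul_right _
  obtain ⟨y, v, hyv⟩ := core A hA p hp k hk q β lam L hAq
    (by
      rw [dotProduct_comm, ← hL]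
      have := congrFun hNe i
      simp only [Pi.smul_apply, smul_eq_mul, mul_one] at this
      exact this)
    (by rw [hqq]; exact hpl.trans (dvd_pow_self _ two_ne_zero)) hqb hi
    (by
      intro v hv
      choose v' hv' using hv
      obtain ⟨r, u, hu⟩ := hz 1 v (fun j => v' j) (by
        ext j
        rw [walk_mulVec, hv']; simp)
      obtain ⟨k', rfl⟩ : ∃ k', k = k' + 1 := ⟨k - 1, by omega⟩
      refine ⟨r * b, r • ((p : ℤ) ^ k') • z' + u, ?_⟩
      rw [hu]
      conv_lhs => rw [hzq]
      ext t
      simp only [Pi.add_apply, Pi.smul_apply, smul_eq_mul]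
      ring)
  obtain ⟨u, hu⟩ := hlast k _ _ hyv hkn
  obtain ⟨k', rfl⟩ : ∃ k', k = k' + 1 := ⟨k - 1, by omega⟩
  apply hi
  refine ⟨u - ((p : ℤ) ^ k') • y, ?_⟩
  rw [smul_sub, ← hu, smul_smul, ← pow_succ']
  abel
end
end
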